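/- arXiv:1202.5725 — 9 statements merged into one kernel-verified Lean document; each statement's English description precedes it below -/
import Mathlib

section
/- In the Artin group Art(D_n), for every r with 3 ≤ r ≤ n−2 one has the identity w_{r+1} s_{r−1} = s_r w_{r+1}. -/
/-- Generators of the Artin group `Art(Dₙ)` : `a = s₁`, `a' = s′₁`,
and `s i` for `2 ≤ i ≤ n − 1`. -/
inductive DGen (n : ℕ) : Type
  | a : DGen n
  | a' : DGen n
  | s : (i : ℕ) → 2 ≤ i → i ≤ n - 1 → DGen n

/-- The generator `s_i` (for `2 ≤ i ≤ n − 1`) as an element of the free group. -/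
def Dfs (n i : ℕ) : FreeGroup (DGen n) :=
  if h : 2 ≤ i ∧ i ≤ n - 1 then FreeGroup.of (DGen.s i h.1 h.2) else 1

/-- The relators of the presentation of the Artin group `Art(Dₙ)` :
`s₁s′₁ = s′₁s₁`; `s₁s₂s₁ = s₂s₁s₂`; `s′₁s₂s′₁ = s₂s′₁s₂`;
`sᵢs_{i+1}sᵢ = s_{i+1}sᵢs_{i+1}` for `2 ≤ i ≤ n−2`;
`sᵢsⱼ = sⱼsᵢ` for `i, j ≥ 2` with `|i−j| ≥ 2`; and
`s₁sⱼ = sⱼs₁`, `s′₁sⱼ = sⱼs′₁` for `j ≥ 3`. -/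
def DRels (n : ℕ) : Set (FreeGroup (DGen n)) :=
  {r | r = FreeGroup.of DGen.a * FreeGroup.of DGen.a' *
          (FreeGroup.of DGen.a' * FreeGroup.of DGen.a)⁻¹ ∨
       r = FreeGroup.of DGen.a * Dfs n 2 * FreeGroup.of DGen.a *
          (Dfs n 2 * FreeGroup.of DGen.a * Dfs n 2)⁻¹ ∨
       r = FreeGroup.of DGen.a' * Dfs n 2 * FreeGroup.of DGen.a' *
          (Dfs n 2 * FreeGroup.of DGen.a' * Dfs n 2)⁻¹ ∨
       (∃ i : ℕ, 2 ≤ i ∧ i ≤ n - 2 ∧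
          r = Dfs n i * Dfs n (i + 1) * Dfs n i *
            (Dfs n (i + 1) * Dfs n i * Dfs n (i + 1))⁻¹) ∨
       (∃ i j : ℕ, 2 ≤ i ∧ i + 2 ≤ j ∧ j ≤ n - 1 ∧
          r = Dfs n i * Dfs n j * (Dfs n j * Dfs n i)⁻¹) ∨
       (∃ j : ℕ, 3 ≤ j ∧ j ≤ n - 1 ∧
          r = FreeGroup.of DGen.a * Dfs n j * (Dfs n j * FreeGroup.of DGen.a)⁻¹) ∨
       (∃ j : ℕ, 3 ≤ j ∧ j ≤ n - 1 ∧
          r = FreeGroup.of DGen.a' * Dfs n j * (Dfs n j * FreeGroup.of DGen.a')⁻¹)}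

/-- The Artin group of type `Dₙ`. -/
abbrev ArtinD (n : ℕ) : Type := PresentedGroup (DRels n)

/-- The generator `s₁` of `Art(Dₙ)`. -/
def Ds1 (n : ℕ) : ArtinD n := PresentedGroup.of DGen.a

/-- The generator `s′₁` of `Art(Dₙ)`. -/
def Ds1' (n : ℕ) : ArtinD n := PresentedGroup.of DGen.a'

/-- The generator `sᵢ` (for `2 ≤ i ≤ n − 1`) of `Art(Dₙ)`. -/
def Ds (n i : ℕ) : ArtinD n :=
  if h : 2 ≤ i ∧ i ≤ n - 1 then PresentedGroup.of (DGen.s i h.1 h.2) else 1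

/-- The element `w_r = s₁s′₁s₂⋯s_r` of `Art(Dₙ)` (for `2 ≤ r ≤ n − 1`). -/
def Dw (n r : ℕ) : ArtinD n :=
  Ds1 n * Ds1' n * ((List.range (r - 1)).map (fun k => Ds n (k + 2))).prod

/-- The Garside element `Δ_r = w_r^{r−1}` of `Art(Dₙ)`. -/
def DDelta (n r : ℕ) : ArtinD n := Dw n r ^ (r - 1)

/-- The element `η_r = s_{r−1}⋯s₂s₁s′₁s₂⋯s_{r−1}` of `Art(Dₙ)`. -/
def Deta (n r : ℕ) : ArtinD n :=
  ((List.range (r - 2)).reverse.map (fun k => Ds n (k + 2))).prod *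
    (Ds1 n * Ds1' n) *
    ((List.range (r - 2)).map (fun k => Ds n (k + 2))).prod

/-- The generator `sᵢ` of `Art(Dₙ)` is the image of the corresponding free generator. -/
theorem mk_Dfs (n i : ℕ) : PresentedGroup.mk (DRels n) (Dfs n i) = Ds n i := by
  unfold Dfs Ds
  split_ifs
  · rfl
  · exact map_one _

theorem Ds_braid {n i : ℕ} (hi : 2 ≤ i) (hin : i ≤ n - 2) :
    Ds n i * Ds n (i + 1) * Ds n i = Ds n (i + 1) * Ds n i * Ds n (i + 1) := by
  simp only [← mk_Dfs, ← map_mul]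
  exact PresentedGroup.mk_eq_mk_of_mul_inv_mem
    (Or.inr (Or.inr (Or.inr (Or.inl ⟨i, hi, hin, rfl⟩))))

theorem commute_Ds_Ds {n i j : ℕ} (hi : 2 ≤ i) (hij : i + 2 ≤ j) (hj : j ≤ n - 1) :
    Commute (Ds n i) (Ds n j) := by
  simp only [commute_iff_eq, ← mk_Dfs, ← map_mul]
  exact PresentedGroup.mk_eq_mk_of_mul_inv_mem
    (Or.inr (Or.inr (Or.inr (Or.inr (Or.inl ⟨i, j, hi, hij, hj, rfl⟩)))))

theorem commute_Ds1_Ds {n j : ℕ} (hj : 3 ≤ j) (hjn : j ≤ n - 1) :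
    Commute (Ds1 n) (Ds n j) := by
  rw [commute_iff_eq, ← mk_Dfs]
  exact PresentedGroup.mk_eq_mk_of_mul_inv_mem
    (Or.inr (Or.inr (Or.inr (Or.inr (Or.inr (Or.inl ⟨j, hj, hjn, rfl⟩))))))

theorem commute_Ds1'_Ds {n j : ℕ} (hj : 3 ≤ j) (hjn : j ≤ n - 1) :
    Commute (Ds1' n) (Ds n j) := by
  rw [commute_iff_eq, ← mk_Dfs]
  exact PresentedGroup.mk_eq_mk_of_mul_inv_mem
    (Or.inr (Or.inr (Or.inr (Or.inr (Or.inr (Or.inr ⟨j, hj, hjn, rfl⟩))))))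

theorem Dw_succ (n : ℕ) {r : ℕ} (hr : 1 ≤ r) : Dw n (r + 1) = Dw n r * Ds n (r + 1) := by
  obtain ⟨r, rfl⟩ := Nat.exists_eq_add_of_le' hr
  simp [Dw, List.range_succ, mul_assoc]

theorem commute_Dw_Ds {n r j : ℕ} (hj : 3 ≤ j) (hrj : r + 2 ≤ j) (hjn : j ≤ n - 1) :
    Commute (Dw n r) (Ds n j) := by
  refine ((commute_Ds1_Ds hj hjn).mul_left (commute_Ds1'_Ds hj hjn)).mul_left
    (Commute.list_prod_left _ _ fun x hx => ?_)
  obtain ⟨k, hk, rfl⟩ := List.mem_map.1 hx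
  have := List.mem_range.1 hk
  exact commute_Ds_Ds (by omega) (by omega) hjn

/-- In the Artin group `Art(Dₙ)`, for every `r` with `3 ≤ r ≤ n − 2`
one has `w_{r+1} s_{r−1} = s_r w_{r+1}`. -/
theorem ArtinD_w_mul_s (n r : ℕ) (hn : 3 ≤ n) (hr : 3 ≤ r) (hrn : r ≤ n - 2) :
    Dw n (r + 1) * Ds n (r - 1) = Ds n r * Dw n (r + 1) := by
  obtain ⟨m, rfl⟩ := Nat.exists_eq_add_of_le' hr
  have hc : Commute (Ds n (m + 2)) (Ds n (m + 4)) :=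
    commute_Ds_Ds (by omega) (by omega) (by omega)
  have hb := Ds_braid (n := n) (i := m + 2) (by omega) (by omega)
  have hw : Commute (Dw n (m + 1)) (Ds n (m + 3)) :=
    commute_Dw_Ds (by omega) (by omega) (by omega)
  have hD : Dw n (m + 3 + 1) = Dw n (m + 1) * Ds n (m + 2) * Ds n (m + 3) * Ds n (m + 4) := by
    rw [Dw_succ n (by omega), Dw_succ n (by omega), Dw_succ n (by omega)]
  rw [hD, show m + 3 - 1 = m + 2 from rfl]
  calc Dw n (m + 1) * Ds n (m + 2) * Ds n (m + 3) * Ds n (m + 4) * Ds n (m + 2)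
      = Dw n (m + 1) * (Ds n (m + 2) * Ds n (m + 3) * Ds n (m + 2)) * Ds n (m + 4) := by
        simp only [mul_assoc, hc.eq]
    _ = Dw n (m + 1) * Ds n (m + 3) * (Ds n (m + 2) * Ds n (m + 3) * Ds n (m + 4)) := by
        rw [hb]
        simp only [mul_assoc]
    _ = Ds n (m + 3) * (Dw n (m + 1) * Ds n (m + 2) * Ds n (m + 3) * Ds n (m + 4)) := by
        rw [hw.eq]
        simp only [mul_assoc]
end

section
/- Let n ≥ 4 and 3 ≤ r ≤ n−1. Let φ : F₂ → Art(D_n) be the group homomorphism from the free group F₂ on two generators x, y to the Artin group Art(D_n) defined by φ(x) = η_r and φ(y) = s_r². Then φ maps the commutator subgroup (F₂, F₂) of F₂ into the centralizer of {s₁, s′₁} in Art(D_n); that is, for every f ∈ (F₂, F₂), the element φ(f) = f(η_r, s_r²) commutes with both s₁ and s′₁. -/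
theorem Ds1_mul_Ds1' (n : ℕ) : Ds1 n * Ds1' n = Ds1' n * Ds1 n :=
  PresentedGroup.mk_eq_mk_of_mul_inv_mem (Or.inl rfl)

theorem Ds1_braid (n : ℕ) : Ds1 n * Ds n 2 * Ds1 n = Ds n 2 * Ds1 n * Ds n 2 := by
  simp only [← mk_Dfs]
  exact PresentedGroup.mk_eq_mk_of_mul_inv_mem (Or.inr <| Or.inl rfl)

theorem Ds1'_braid (n : ℕ) : Ds1' n * Ds n 2 * Ds1' n = Ds n 2 * Ds1' n * Ds n 2 := by
  simp only [← mk_Dfs]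
  exact PresentedGroup.mk_eq_mk_of_mul_inv_mem (Or.inr <| Or.inr <| Or.inl rfl)

theorem commute_Ds_Ds1 {n j : ℕ} (hj : 3 ≤ j) (hjn : j ≤ n - 1) :
    Commute (Ds n j) (Ds1 n) := by
  refine Commute.symm (?_ : Ds1 n * Ds n j = Ds n j * Ds1 n)
  simp only [← mk_Dfs]
  exact PresentedGroup.mk_eq_mk_of_mul_inv_mem
    (Or.inr <| Or.inr <| Or.inr <| Or.inr <| Or.inr <| Or.inl ⟨j, hj, hjn, rfl⟩)

theorem commute_Ds_Ds1' {n j : ℕ} (hj : 3 ≤ j) (hjn : j ≤ n - 1) :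
    Commute (Ds n j) (Ds1' n) := by
  refine Commute.symm (?_ : Ds1' n * Ds n j = Ds n j * Ds1' n)
  simp only [← mk_Dfs]
  exact PresentedGroup.mk_eq_mk_of_mul_inv_mem
    (Or.inr <| Or.inr <| Or.inr <| Or.inr <| Or.inr <| Or.inr ⟨j, hj, hjn, rfl⟩)

theorem Deta_two (n : ℕ) : Deta n 2 = Ds1 n * Ds1' n := by
  simp [Deta]

theorem Deta_succ {n r : ℕ} (hr : 2 ≤ r) :
    Deta n (r + 1) = Ds n r * Deta n r * Ds n r := by
  obtain ⟨k, rfl⟩ := Nat.exists_eq_add_of_le' hr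
  have h : k + 2 + 1 - 2 = k + 1 := by omega
  simp [Deta, h, List.range_succ, mul_assoc]

/-- If `a`, `b` commute and both braid with `s`, then `s * (a * b) * s` conjugates `a` to `b`. -/
theorem semiconjBy_of_braid {G : Type*} [Group G] {a b s : G} (hab : a * b = b * a)
    (ha : a * s * a = s * a * s) (hb : b * s * b = s * b * s) :
    SemiconjBy (s * (a * b) * s) a b :=
  calc s * (a * b) * s * a = s * b * (a * s * a) := by rw [hab]; simp only [mul_assoc]
    _ = s * b * s * a * s := by rw [ha]; simp only [mul_assoc]
    _ = b * (s * (a * b) * s) := by rw [← hb, hab]; simp only [mul_assoc]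

/-- `η_r` interchanges `s₁` and `s′₁` by conjugation. -/
theorem semiconjBy_Deta {n r : ℕ} (hr : 3 ≤ r) (hrn : r ≤ n) :
    SemiconjBy (Deta n r) (Ds1 n) (Ds1' n) ∧ SemiconjBy (Deta n r) (Ds1' n) (Ds1 n) := by
  induction r, hr using Nat.le_induction with
  | base =>
    rw [Deta_succ le_rfl, Deta_two]
    refine ⟨semiconjBy_of_braid (Ds1_mul_Ds1' n) (Ds1_braid n) (Ds1'_braid n), ?_⟩
    rw [Ds1_mul_Ds1']
    exact semiconjBy_of_braid (Ds1_mul_Ds1' n).symm (Ds1'_braid n) (Ds1_braid n)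
  | succ r hr ih =>
    obtain ⟨h, h'⟩ := ih (by omega)
    have c := commute_Ds_Ds1 hr (by omega : r ≤ n - 1)
    have c' := commute_Ds_Ds1' hr (by omega : r ≤ n - 1)
    rw [Deta_succ (by omega)]
    exact ⟨(SemiconjBy.mul_left c' h).mul_left c, (SemiconjBy.mul_left c h').mul_left c'⟩

/-- If, in the free group on `α`, every generator acts by conjugation on a family `e` of elements
indexed by an abelian group through a translation, then so does every word; in particular
commutator words centralize the family. -/
theorem commute_lift_of_mem_commutator {G α A : Type*} [Group G] [AddCommGroup A]
    {g : α → G} {t : α → A} {e : A → G}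
    (h : ∀ i b, SemiconjBy (g i) (e b) (e (t i + b)))
    {f : FreeGroup α} (hf : f ∈ commutator (FreeGroup α)) (b : A) :
    Commute (FreeGroup.lift g f) (e b) := by
  let τ : FreeGroup α →* Multiplicative A := FreeGroup.lift fun i => Multiplicative.ofAdd (t i)
  have key : ∀ w b, SemiconjBy (FreeGroup.lift g w) (e b) (e ((τ w).toAdd + b)) := by
    intro w
    induction w using FreeGroup.induction_on with
    | C1 => simp
    | of i => simpa [τ] using h i
    | inv_of i _ =>
      intro b
      have := (h i (-t i + b)).inv_symm_left
      simpa [τ] using this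
    | mul x y hx hy =>
      intro b
      rw [map_mul, map_mul, toAdd_mul, add_assoc]
      exact (hx _).mul_left (hy b)
  have hτ : τ f = 1 := Abelianization.commutator_subset_ker τ hf
  simpa [hτ, Commute] using key f b

/-- Let `n ≥ 4` and `3 ≤ r ≤ n − 1`. The homomorphism
`φ : F₂ → Art(Dₙ)` from the free group on two generators `x, y` with `φ(x) = η_r` and
`φ(y) = s_r²` maps the commutator subgroup `(F₂, F₂)` into the centralizer of
`{s₁, s′₁}` : for every `f ∈ (F₂, F₂)`, the element `φ(f) = f(η_r, s_r²)` commutes with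
both `s₁` and `s′₁`. -/
theorem ArtinD_commutator_word_centralizes (n r : ℕ) (hn : 4 ≤ n) (hr : 3 ≤ r)
    (hrn : r ≤ n - 1) (f : FreeGroup (Fin 2)) (hf : f ∈ commutator (FreeGroup (Fin 2))) :
    FreeGroup.lift ![Deta n r, Ds n r ^ 2] f * Ds1 n =
      Ds1 n * FreeGroup.lift ![Deta n r, Ds n r ^ 2] f ∧
    FreeGroup.lift ![Deta n r, Ds n r ^ 2] f * Ds1' n =
      Ds1' n * FreeGroup.lift ![Deta n r, Ds n r ^ 2] f := by
  have h : ∀ i b, SemiconjBy (![Deta n r, Ds n r ^ 2] i) (![Ds1 n, Ds1' n] b)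
      (![Ds1 n, Ds1' n] (![(1 : Fin 2), 0] i + b)) := by
    obtain ⟨hη, hη'⟩ := semiconjBy_Deta hr (by omega : r ≤ n)
    have c : SemiconjBy _ _ _ := (commute_Ds_Ds1 hr hrn).pow_left 2
    have c' : SemiconjBy _ _ _ := (commute_Ds_Ds1' hr hrn).pow_left 2
    intro i b
    fin_cases i <;> fin_cases b
    exacts [hη, hη', c, c']
  exact ⟨commute_lift_of_mem_commutator h hf 0, commute_lift_of_mem_commutator h hf 1⟩
end

section
/- Let n ≥ 3, let λ be an integer and let f be an element of the commutator subgroup (F₂, F₂) of the free group F₂ on two generators. In the Artin group Art(D_n), define F(s₁) = s₁^λ, F(s′₁) = (s′₁)^λ, and F(s_i) = f(s_i², η_i) · s_i^λ · f(η_i, s_i²) for 2 ≤ i ≤ n−1. Then F(s_i) F(s_j) = F(s_j) F(s_i) whenever 1 ≤ i, j ≤ n−1 and |i−j| ≥ 2, and F(s′₁) F(s_j) = F(s_j) F(s′₁) whenever 3 ≤ j ≤ n−1. -/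
/-- The elements `F(s₁) = s₁^λ` and, for `2 ≤ i ≤ n−1`,
`F(s_i) = f(s_i², η_i) · s_i^λ · f(η_i, s_i²)`, where `f(a,b)` denotes the image of the
element `f` of the free group on two generators `x, y` under `x ↦ a`, `y ↦ b`. -/
def DF (n : ℕ) (lam : ℤ) (f : FreeGroup (Fin 2)) (i : ℕ) : ArtinD n :=
  if i = 1 then Ds1 n ^ lam
  else FreeGroup.lift ![Ds n i ^ 2, Deta n i] f * Ds n i ^ lam *
    FreeGroup.lift ![Deta n i, Ds n i ^ 2] f

theorem commute_lift_pair {G : Type*} [Group G] {g a b : G} (ha : Commute g a)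
    (hb : Commute g b) (f : FreeGroup (Fin 2)) : Commute g (FreeGroup.lift ![a, b] f) := by
  induction f using FreeGroup.induction_on with
  | C1 => simp
  | of x => fin_cases x <;> simpa
  | inv_of x h => simpa using h.inv_right
  | mul x y hx hy => simpa using hx.mul_right hy

/-- Conjugation by `g` fixes both `x` and `y`, or exchanges them. -/
def FixesOrSwaps {G : Type*} [Group G] (x y g : G) : Prop :=
  (SemiconjBy g x x ∧ SemiconjBy g y y) ∨ (SemiconjBy g x y ∧ SemiconjBy g y x)

namespace FixesOrSwaps

open scoped commutatorElement

variable {G : Type*} [Group G] {x y a b : G}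

theorem mul (ha : FixesOrSwaps x y a) (hb : FixesOrSwaps x y b) :
    FixesOrSwaps x y (a * b) := by
  rcases ha with ⟨h₁, h₂⟩ | ⟨h₁, h₂⟩ <;> rcases hb with ⟨h₃, h₄⟩ | ⟨h₃, h₄⟩
  · exact .inl ⟨h₁.mul_left h₃, h₂.mul_left h₄⟩
  · exact .inr ⟨h₂.mul_left h₃, h₁.mul_left h₄⟩
  · exact .inr ⟨h₁.mul_left h₃, h₂.mul_left h₄⟩
  · exact .inl ⟨h₂.mul_left h₃, h₁.mul_left h₄⟩

theorem inv (ha : FixesOrSwaps x y a) : FixesOrSwaps x y a⁻¹ := by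
  rcases ha with ⟨h₁, h₂⟩ | ⟨h₁, h₂⟩
  · exact .inl ⟨h₁.inv_symm_left, h₂.inv_symm_left⟩
  · exact .inr ⟨h₂.inv_symm_left, h₁.inv_symm_left⟩

theorem lift_pair (ha : FixesOrSwaps x y a) (hb : FixesOrSwaps x y b)
    (f : FreeGroup (Fin 2)) : FixesOrSwaps x y (FreeGroup.lift ![a, b] f) := by
  induction f using FreeGroup.induction_on with
  | C1 => exact .inl (by simp)
  | of x => fin_cases x <;> simpa
  | inv_of x h => simpa using h.inv
  | mul x y hx hy => simpa using hx.mul hy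

theorem commute_commutatorElement (ha : FixesOrSwaps x y a) (hb : FixesOrSwaps x y b) :
    Commute ⁅a, b⁆ x := by
  rw [commutatorElement_def]
  rcases ha with ⟨h₁, h₂⟩ | ⟨h₁, h₂⟩ <;> rcases hb with ⟨h₃, h₄⟩ | ⟨h₃, h₄⟩
  · exact ((h₁.mul_left h₃).mul_left h₁.inv_symm_left).mul_left h₃.inv_symm_left
  · exact ((h₁.mul_left h₄).mul_left h₂.inv_symm_left).mul_left h₄.inv_symm_left
  · exact ((h₂.mul_left h₄).mul_left h₂.inv_symm_left).mul_left h₃.inv_symm_left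
  · exact ((h₂.mul_left h₃).mul_left h₁.inv_symm_left).mul_left h₄.inv_symm_left

theorem commute_lift_pair (ha : FixesOrSwaps x y a) (hb : FixesOrSwaps x y b)
    {f : FreeGroup (Fin 2)} (hf : f ∈ commutator (FreeGroup (Fin 2))) :
    Commute x (FreeGroup.lift ![a, b] f) := by
  have key : commutator (FreeGroup (Fin 2)) ≤
      (Subgroup.centralizer {x}).comap (FreeGroup.lift ![a, b]) := by
    rw [commutator_def, Subgroup.commutator_le]
    intro p _ q _
    rw [Subgroup.mem_comap, Subgroup.mem_centralizer_singleton_iff, map_commutatorElement]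
    exact (ha.lift_pair hb p).commute_commutatorElement (ha.lift_pair hb q)
  exact (Subgroup.mem_centralizer_singleton_iff.1 (key hf)).symm

end FixesOrSwaps

namespace ArtinD

variable {n : ℕ}

theorem mk_eq_mk {u v : FreeGroup (DGen n)} (h : u * v⁻¹ ∈ DRels n) :
    PresentedGroup.mk (DRels n) u = PresentedGroup.mk (DRels n) v := by
  rw [← mul_inv_eq_one, ← map_inv, ← map_mul]
  exact PresentedGroup.one_of_mem h

theorem mk_a : PresentedGroup.mk (DRels n) (.of .a) = Ds1 n := rfl

theorem mk_a' : PresentedGroup.mk (DRels n) (.of .a') = Ds1' n := rfl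

theorem mk_Dfs (i : ℕ) : PresentedGroup.mk (DRels n) (Dfs n i) = Ds n i := by
  unfold Dfs Ds
  split_ifs
  · rfl
  · simp

theorem Ds_eq_one {i : ℕ} (h : n - 1 < i) : Ds n i = 1 := by
  rw [Ds, dif_neg (by omega)]

theorem commute_Ds1_Ds1' : Commute (Ds1 n) (Ds1' n) := by
  simpa only [map_mul, mk_a, mk_a', commute_iff_eq] using
      mk_eq_mk (n := n) (u := .of .a * .of .a') (v := .of .a' * .of .a) (.inl rfl)

theorem braid_Ds1 : Ds1 n * Ds n 2 * Ds1 n = Ds n 2 * Ds1 n * Ds n 2 := by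
  simpa only [map_mul, mk_Dfs, mk_a] using mk_eq_mk (n := n) (u := .of .a * Dfs n 2 * .of .a)
    (v := Dfs n 2 * .of .a * Dfs n 2) (.inr (.inl rfl))

theorem braid_Ds1' : Ds1' n * Ds n 2 * Ds1' n = Ds n 2 * Ds1' n * Ds n 2 := by
  simpa only [map_mul, mk_Dfs, mk_a'] using mk_eq_mk (n := n) (u := .of .a' * Dfs n 2 * .of .a')
    (v := Dfs n 2 * .of .a' * Dfs n 2) (.inr (.inr (.inl rfl)))

theorem braid_Ds {i : ℕ} (h2 : 2 ≤ i) (hi : i + 1 ≤ n - 1) :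
    Ds n i * Ds n (i + 1) * Ds n i = Ds n (i + 1) * Ds n i * Ds n (i + 1) := by
  simpa only [map_mul, mk_Dfs] using mk_eq_mk (n := n) (u := Dfs n i * Dfs n (i + 1) * Dfs n i)
    (v := Dfs n (i + 1) * Dfs n i * Dfs n (i + 1))
    (.inr (.inr (.inr (.inl ⟨i, h2, by omega, rfl⟩))))

theorem commute_Ds {i j : ℕ} (h2 : 2 ≤ i) (hij : i + 2 ≤ j) : Commute (Ds n i) (Ds n j) := by
  rcases lt_or_ge (n - 1) j with hj | hj
  · simp [Ds_eq_one hj]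
  · simpa only [map_mul, mk_Dfs, commute_iff_eq] using mk_eq_mk (n := n) (u := Dfs n i * Dfs n j)
      (v := Dfs n j * Dfs n i) (.inr (.inr (.inr (.inr (.inl ⟨i, j, h2, hij, hj, rfl⟩)))))

theorem commute_Ds1_Ds {j : ℕ} (h : 3 ≤ j) : Commute (Ds1 n) (Ds n j) := by
  rcases lt_or_ge (n - 1) j with hj | hj
  · simp [Ds_eq_one hj]
  · simpa only [map_mul, mk_Dfs, mk_a, commute_iff_eq] using
      mk_eq_mk (n := n) (u := .of .a * Dfs n j)
      (v := Dfs n j * .of .a) (.inr (.inr (.inr (.inr (.inr (.inl ⟨j, h, hj, rfl⟩))))))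

theorem commute_Ds1'_Ds {j : ℕ} (h : 3 ≤ j) : Commute (Ds1' n) (Ds n j) := by
  rcases lt_or_ge (n - 1) j with hj | hj
  · simp [Ds_eq_one hj]
  · simpa only [map_mul, mk_Dfs, mk_a', commute_iff_eq] using
      mk_eq_mk (n := n) (u := .of .a' * Dfs n j)
      (v := Dfs n j * .of .a') (.inr (.inr (.inr (.inr (.inr (.inr ⟨j, h, hj, rfl⟩))))))

theorem Deta_two : Deta n 2 = Ds1 n * Ds1' n := by simp [Deta]

theorem Deta_succ {r : ℕ} (h : 2 ≤ r) : Deta n (r + 1) = Ds n r * Deta n r * Ds n r := by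
  obtain ⟨k, rfl⟩ := Nat.exists_eq_add_of_le' h
  simp [Deta, List.range_succ, show k + 2 + 1 - 2 = k + 1 by omega, mul_assoc]

theorem commute_Deta_of_lt {r j : ℕ} (hr : 2 ≤ r) (hj : r + 1 ≤ j) :
    Commute (Deta n r) (Ds n j) := by
  induction r, hr using Nat.le_induction with
  | base =>
    rw [Deta_two]
    exact (commute_Ds1_Ds hj).mul_left (commute_Ds1'_Ds hj)
  | succ r hr ih =>
    rw [Deta_succ hr]
    have h := commute_Ds (n := n) hr hj
    exact (h.mul_left (ih (by omega))).mul_left h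

theorem commute_Ds_Deta {k r : ℕ} (hk : 2 ≤ k) (hr : k + 2 ≤ r) (hn : r ≤ n) :
    Commute (Ds n k) (Deta n r) := by
  induction r, hr using Nat.le_induction with
  | base =>
    have hb := braid_Ds (n := n) hk (by omega)
    have hc := (commute_Deta_of_lt (n := n) hk le_rfl).eq
    rw [Deta_succ (by omega), Deta_succ hk, commute_iff_eq]
    generalize Ds n k = s at *
    generalize Ds n (k + 1) = t at *
    generalize Deta n k = e at *
    calc s * (t * (s * e * s) * t) = s * t * s * (e * s * t) := by group
      _ = t * s * (t * e) * s * t := by rw [hb]; group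
      _ = t * s * e * (t * s * t) := by rw [← hc]; group
      _ = t * (s * e * s) * t * s := by rw [← hb]; group
  | succ r hr ih =>
    rw [Deta_succ (by omega)]
    have h := commute_Ds (n := n) hk hr
    exact (h.mul_right (ih (by omega))).mul_right h

theorem semiconjBy_conj_mul {G : Type*} [Group G] {x y s : G} (hxy : Commute x y)
    (hx : x * s * x = s * x * s) (hy : y * s * y = s * y * s) :
    SemiconjBy (s * (x * y) * s) x y := by
  have hc := hxy.eq
  calc s * (x * y) * s * x = s * y * (x * s * x) := by rw [hc]; group
    _ = s * y * s * x * s := by rw [hx]; group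
    _ = y * s * (y * x) * s := by rw [← hy]; group
    _ = y * (s * (x * y) * s) := by rw [hc]; group

theorem semiconjBy_Deta {r : ℕ} (hr : 3 ≤ r) :
    SemiconjBy (Deta n r) (Ds1 n) (Ds1' n) ∧ SemiconjBy (Deta n r) (Ds1' n) (Ds1 n) := by
  induction r, hr using Nat.le_induction with
  | base =>
    rw [Deta_succ le_rfl, Deta_two]
    refine ⟨semiconjBy_conj_mul commute_Ds1_Ds1' braid_Ds1 braid_Ds1', ?_⟩
    rw [commute_Ds1_Ds1'.eq]
    exact semiconjBy_conj_mul commute_Ds1_Ds1'.symm braid_Ds1' braid_Ds1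
  | succ r hr ih =>
    rw [Deta_succ (by omega)]
    have h : SemiconjBy (Ds n r) (Ds1 n) (Ds1 n) := (commute_Ds1_Ds hr).symm
    have h' : SemiconjBy (Ds n r) (Ds1' n) (Ds1' n) := (commute_Ds1'_Ds hr).symm
    exact ⟨(h'.mul_left ih.1).mul_left h, (h.mul_left ih.2).mul_left h'⟩

theorem commute_Deta {i j : ℕ} (hi : 2 ≤ i) (hij : i + 1 ≤ j) (hj : j ≤ n) :
    Commute (Deta n i) (Deta n j) := by
  induction i, hi using Nat.le_induction with
  | base =>
    obtain ⟨h, h'⟩ := semiconjBy_Deta (n := n) hij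
    have := h.mul_right h'
    rw [Deta_two]
    rw [← commute_Ds1_Ds1'.eq] at this
    exact Commute.symm this
  | succ i hi ih =>
    rw [Deta_succ hi]
    have h := commute_Ds_Deta hi hij hj
    exact (h.mul_left (ih (by omega))).mul_left h

variable {lam : ℤ} {f : FreeGroup (Fin 2)}

theorem commute_DF {g : ArtinD n} {i : ℕ} (hi : 2 ≤ i) (hs : Commute g (Ds n i))
    (he : Commute g (Deta n i)) : Commute g (DF n lam f i) := by
  rw [DF, if_neg (by omega)]
  exact ((commute_lift_pair (hs.pow_right 2) he f).mul_right (hs.zpow_right lam)).mul_right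
    (commute_lift_pair he (hs.pow_right 2) f)

theorem commute_DF_of_fixesOrSwaps {x y : ArtinD n} {j : ℕ} (hj : 2 ≤ j)
    (hx : Commute x (Ds n j)) (hy : Commute y (Ds n j)) (he : FixesOrSwaps x y (Deta n j))
    (hf : f ∈ commutator (FreeGroup (Fin 2))) : Commute x (DF n lam f j) := by
  have hs : FixesOrSwaps x y (Ds n j ^ 2) :=
    .inl ⟨(hx.pow_right 2).symm, (hy.pow_right 2).symm⟩
  rw [DF, if_neg (by omega)]
  exact ((hs.commute_lift_pair he hf).mul_right (hx.zpow_right lam)).mul_right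
    (he.commute_lift_pair hs hf)

theorem commute_Ds1_DF {j : ℕ} (hj : 3 ≤ j) (hf : f ∈ commutator (FreeGroup (Fin 2))) :
    Commute (Ds1 n) (DF n lam f j) :=
  commute_DF_of_fixesOrSwaps (by omega) (commute_Ds1_Ds hj) (commute_Ds1'_Ds hj)
    (.inr (semiconjBy_Deta hj)) hf

theorem commute_Ds1'_DF {j : ℕ} (hj : 3 ≤ j) (hf : f ∈ commutator (FreeGroup (Fin 2))) :
    Commute (Ds1' n) (DF n lam f j) :=
  commute_DF_of_fixesOrSwaps (by omega) (commute_Ds1'_Ds hj) (commute_Ds1_Ds hj)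
    (.inr (semiconjBy_Deta hj).symm) hf

theorem commute_DF_DF {i j : ℕ} (hi : 1 ≤ i) (hij : i + 2 ≤ j) (hj : j ≤ n - 1)
    (hf : f ∈ commutator (FreeGroup (Fin 2))) :
    Commute (DF n lam f i) (DF n lam f j) := by
  rcases hi.eq_or_lt with rfl | hi
  · rw [DF, if_pos rfl]
    exact (commute_Ds1_DF hij hf).zpow_left lam
  · have hi : 2 ≤ i := hi
    refine commute_DF (by omega) (Commute.symm ?_) (Commute.symm ?_)
    · exact commute_DF hi (commute_Ds hi hij).symm (commute_Deta_of_lt hi (by omega)).symm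
    · exact commute_DF hi (commute_Ds_Deta hi hij (by omega)).symm
        (commute_Deta hi (by omega) (by omega)).symm

end ArtinD

/-- Let `n ≥ 3`, `λ ∈ ℤ` and `f ∈ (F₂, F₂)`. In `Art(Dₙ)`, with
`F(s₁) = s₁^λ`, `F(s′₁) = (s′₁)^λ` and `F(s_i) = f(s_i², η_i) s_i^λ f(η_i, s_i²)` for
`2 ≤ i ≤ n−1`, one has `F(s_i) F(s_j) = F(s_j) F(s_i)` whenever `1 ≤ i, j ≤ n−1` with
`|i−j| ≥ 2`, and `F(s′₁) F(s_j) = F(s_j) F(s′₁)` whenever `3 ≤ j ≤ n−1`. -/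
theorem ArtinD_GT_formulas_commutation (n : ℕ) (hn : 3 ≤ n) (lam : ℤ)
    (f : FreeGroup (Fin 2)) (hf : f ∈ commutator (FreeGroup (Fin 2))) :
    (∀ i j : ℕ, 1 ≤ i → i ≤ n - 1 → 1 ≤ j → j ≤ n - 1 → (i + 2 ≤ j ∨ j + 2 ≤ i) →
      DF n lam f i * DF n lam f j = DF n lam f j * DF n lam f i) ∧
    (∀ j : ℕ, 3 ≤ j → j ≤ n - 1 →
      Ds1' n ^ lam * DF n lam f j = DF n lam f j * Ds1' n ^ lam) := by
  refine ⟨fun i j hi hi' hj hj' hij => ?_, fun j hj _ => ?_⟩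
  · rcases hij with hij | hij
    · exact ArtinD.commute_DF_DF hi hij hj' hf
    · exact (ArtinD.commute_DF_DF hj hij hi' hf).symm
  · exact (ArtinD.commute_Ds1'_DF hj hf).zpow_left lam
end

section
/- Let B be the presented group with generators s, t, u and relations stus = tust and tust = ustu (the braid group of the complex reflection group G₁₂). Then there exists an automorphism σ of B with σ(s) = t⁻¹, σ(t) = s⁻¹, σ(u) = u⁻¹, and σ ∘ σ = id. -/
/-- Generators `s, t, u` of the braid group of the complex reflection group `G₁₂`. -/
inductive G12Gen : Type
  | s : G12Gen
  | t : G12Gen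
  | u : G12Gen

open FreeGroup in
/-- The relators `stus(tust)⁻¹` and `tust(ustu)⁻¹` of the presentation
`⟨s, t, u ∣ stus = tust = ustu⟩`. -/
def G12Rels : Set (FreeGroup G12Gen) :=
  { of .s * of .t * of .u * of .s * (of .t * of .u * of .s * of .t)⁻¹,
    of .t * of .u * of .s * of .t * (of .u * of .s * of .t * of .u)⁻¹ }

/-- The braid group of `G₁₂`, presented as `⟨s, t, u ∣ stus = tust = ustu⟩`. -/
abbrev BraidG12 : Type := PresentedGroup G12Rels

namespace BraidG12

open PresentedGroup

theorem stus_eq_tust :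
    (of .s * of .t * of .u * of .s : BraidG12) = of .t * of .u * of .s * of .t :=
  mul_inv_eq_one.mp (one_of_mem (rels := G12Rels) (Or.inl rfl))

theorem tust_eq_ustu :
    (of .t * of .u * of .s * of .t : BraidG12) = of .u * of .s * of .t * of .u :=
  mul_inv_eq_one.mp (one_of_mem (rels := G12Rels) (Or.inr rfl))

/-- The images `t⁻¹, s⁻¹, u⁻¹` of the generators `s, t, u`. -/
def conjGen : G12Gen → BraidG12
  | .s => (of .t)⁻¹
  | .t => (of .s)⁻¹
  | .u => (of .u)⁻¹

theorem lift_conjGen_eq_one : ∀ r ∈ G12Rels, FreeGroup.lift conjGen r = 1 := by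
  have h₁ := congrArg (·⁻¹) stus_eq_tust
  have h₂ := congrArg (·⁻¹) tust_eq_ustu
  simp only [mul_inv_rev, ← mul_assoc] at h₁ h₂
  rintro r (rfl | rfl) <;>
    simp only [map_mul, map_inv, FreeGroup.lift_apply_of, conjGen, mul_inv_eq_one]
  · exact h₁.symm
  · exact h₁.trans h₂

/-- The endomorphism `s ↦ t⁻¹, t ↦ s⁻¹, u ↦ u⁻¹`. -/
def conjHom : BraidG12 →* BraidG12 := toGroup lift_conjGen_eq_one

theorem conjHom_of (x : G12Gen) : conjHom (of x) = conjGen x :=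
  toGroup.of lift_conjGen_eq_one

theorem conjHom_comp_conjHom : conjHom.comp conjHom = MonoidHom.id BraidG12 := by
  ext x
  cases x <;> simp [conjHom_of, conjGen]

end BraidG12

/-- The braid group `B = ⟨s, t, u ∣ stus = tust = ustu⟩` of `G₁₂`
admits an automorphism `σ` of order two with `σ(s) = t⁻¹`, `σ(t) = s⁻¹`, `σ(u) = u⁻¹`
(realizing the complex conjugation). -/
theorem braidG12_conjugation_automorphism :
    ∃ σ : BraidG12 ≃* BraidG12,
      σ (PresentedGroup.of G12Gen.s) = (PresentedGroup.of G12Gen.t)⁻¹ ∧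
      σ (PresentedGroup.of G12Gen.t) = (PresentedGroup.of G12Gen.s)⁻¹ ∧
      σ (PresentedGroup.of G12Gen.u) = (PresentedGroup.of G12Gen.u)⁻¹ ∧
      ∀ g : BraidG12, σ (σ g) = g := by
  exact ⟨MonoidHom.toMulEquiv BraidG12.conjHom BraidG12.conjHom
      BraidG12.conjHom_comp_conjHom BraidG12.conjHom_comp_conjHom,
    BraidG12.conjHom_of .s, BraidG12.conjHom_of .t, BraidG12.conjHom_of .u,
    DFunLike.congr_fun BraidG12.conjHom_comp_conjHom⟩
end

section
/- Let e ≥ 1 and n ≥ 3, and let B be the presented group with generators t_i for i ∈ ℤ/eℤ and s₃, s₄, …, s_n, and relations: t_{i+1} t_i = t_{j+1} t_j for all i, j ∈ ℤ/eℤ; s₃ t_i s₃ = t_i s₃ t_i for all i; t_i s_j = s_j t_i for all i and all j ≥ 5; s_i s_{i+1} s_i = s_{i+1} s_i s_{i+1} for 3 ≤ i ≤ n−1; and s_i s_j = s_j s_i for i, j ≥ 3 with |i−j| ≥ 2. Then there exists an automorphism σ of B with σ(s_k) = s_k⁻¹ for 3 ≤ k ≤ n, σ(t_i) = t_{−i}⁻¹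 for all i ∈ ℤ/eℤ, and σ ∘ σ = id. -/
/-- Generators of the Corran–Picantin presentation of the braid group of `G(e,e,n)` :
`t i` for `i ∈ ℤ/eℤ`, and `s k` for `3 ≤ k ≤ n`. -/
inductive CPGen (e n : ℕ) : Type
  | t : ZMod e → CPGen e n
  | s : (k : ℕ) → 3 ≤ k → k ≤ n → CPGen e n

/-- The generator `t i` as an element of the free group. -/
def CPft (e n : ℕ) (i : ZMod e) : FreeGroup (CPGen e n) :=
  FreeGroup.of (CPGen.t i)

/-- The generator `s k` (for `3 ≤ k ≤ n`) as an element of the free group. -/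
def CPfs (e n : ℕ) (k : ℕ) : FreeGroup (CPGen e n) :=
  if h : 3 ≤ k ∧ k ≤ n then FreeGroup.of (CPGen.s k h.1 h.2) else 1

/-- The relators of the Corran–Picantin presentation of the braid group of `G(e,e,n)` :
`t_{i+1} t_i = t_{j+1} t_j`, `s₃ t_i s₃ = t_i s₃ t_i`, `t_i s_j = s_j t_i` for `j ≥ 5`,
the braid relations `s_k s_{k+1} s_k = s_{k+1} s_k s_{k+1}`, and the commutation relations
`s_k s_l = s_l s_k` for `|k−l| ≥ 2`. -/
def CPRels (e n : ℕ) : Set (FreeGroup (CPGen e n)) :=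
  {r | (∃ i j : ZMod e,
          r = CPft e n (i + 1) * CPft e n i * (CPft e n (j + 1) * CPft e n j)⁻¹) ∨
       (∃ i : ZMod e,
          r = CPfs e n 3 * CPft e n i * CPfs e n 3 *
            (CPft e n i * CPfs e n 3 * CPft e n i)⁻¹) ∨
       (∃ (i : ZMod e) (j : ℕ), 5 ≤ j ∧ j ≤ n ∧
          r = CPft e n i * CPfs e n j * (CPfs e n j * CPft e n i)⁻¹) ∨
       (∃ k : ℕ, 3 ≤ k ∧ k + 1 ≤ n ∧
          r = CPfs e n k * CPfs e n (k + 1) * CPfs e n k *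
            (CPfs e n (k + 1) * CPfs e n k * CPfs e n (k + 1))⁻¹) ∨
       (∃ k l : ℕ, 3 ≤ k ∧ k + 2 ≤ l ∧ l ≤ n ∧
          r = CPfs e n k * CPfs e n l * (CPfs e n l * CPfs e n k)⁻¹)}

/-- The braid group of the complex reflection group `G(e,e,n)`,
with its Corran–Picantin presentation. -/
abbrev CPBraid (e n : ℕ) : Type := PresentedGroup (CPRels e n)

/-- The generator `t i` of the braid group of `G(e,e,n)`. -/
def CPt (e n : ℕ) (i : ZMod e) : CPBraid e n := PresentedGroup.of (CPGen.t i)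

/-- The generator `s k` (`3 ≤ k ≤ n`) of the braid group of `G(e,e,n)`. -/
def CPs (e n : ℕ) (k : ℕ) : CPBraid e n :=
  if h : 3 ≤ k ∧ k ≤ n then PresentedGroup.of (CPGen.s k h.1 h.2) else 1

theorem CPBraid_mul_inv_eq_one {e n : ℕ} {a b : FreeGroup (CPGen e n)}
    (h : a * b⁻¹ ∈ CPRels e n) :
    PresentedGroup.mk (CPRels e n) a = PresentedGroup.mk (CPRels e n) b := by
  rw [← mul_inv_eq_one, ← map_inv, ← map_mul]
  exact PresentedGroup.one_of_mem h

theorem CPBraid_mk_CPft (e n : ℕ) (i : ZMod e) :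
    PresentedGroup.mk (CPRels e n) (CPft e n i) = CPt e n i := rfl

theorem CPBraid_mk_CPfs (e n k : ℕ) :
    PresentedGroup.mk (CPRels e n) (CPfs e n k) = CPs e n k := by
  unfold CPfs CPs
  split_ifs
  · rfl
  · exact map_one _

theorem CPt_mul_CPt (e n : ℕ) (i j : ZMod e) :
    CPt e n (i + 1) * CPt e n i = CPt e n (j + 1) * CPt e n j := by
  have h := CPBraid_mul_inv_eq_one (e := e) (n := n) (Or.inl ⟨i, j, rfl⟩)
  simpa only [map_mul, CPBraid_mk_CPft] using h

theorem CPs_three_braid_CPt (e n : ℕ) (i : ZMod e) :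
    CPs e n 3 * CPt e n i * CPs e n 3 = CPt e n i * CPs e n 3 * CPt e n i := by
  have h := CPBraid_mul_inv_eq_one (e := e) (n := n) (Or.inr (Or.inl ⟨i, rfl⟩))
  simpa only [map_mul, CPBraid_mk_CPft, CPBraid_mk_CPfs] using h

theorem CPt_mul_CPs (e n : ℕ) (i : ZMod e) {j : ℕ} (hj : 5 ≤ j) (hjn : j ≤ n) :
    CPt e n i * CPs e n j = CPs e n j * CPt e n i := by
  have h := CPBraid_mul_inv_eq_one (e := e) (n := n)
    (Or.inr (Or.inr (Or.inl ⟨i, j, hj, hjn, rfl⟩)))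
  simpa only [map_mul, CPBraid_mk_CPft, CPBraid_mk_CPfs] using h

theorem CPs_braid_CPs (e : ℕ) {n k : ℕ} (hk : 3 ≤ k) (hkn : k + 1 ≤ n) :
    CPs e n k * CPs e n (k + 1) * CPs e n k =
      CPs e n (k + 1) * CPs e n k * CPs e n (k + 1) := by
  have h := CPBraid_mul_inv_eq_one (e := e) (n := n)
    (Or.inr (Or.inr (Or.inr (Or.inl ⟨k, hk, hkn, rfl⟩))))
  simpa only [map_mul, CPBraid_mk_CPfs] using h

theorem CPs_mul_CPs (e : ℕ) {n k l : ℕ} (hk : 3 ≤ k) (hkl : k + 2 ≤ l) (hln : l ≤ n) :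
    CPs e n k * CPs e n l = CPs e n l * CPs e n k := by
  have h := CPBraid_mul_inv_eq_one (e := e) (n := n)
    (Or.inr (Or.inr (Or.inr (Or.inr ⟨k, l, hk, hkl, hln, rfl⟩))))
  simpa only [map_mul, CPBraid_mk_CPfs] using h

/-- The images of the generators under complex conjugation. -/
def CPBraidConjGen (e n : ℕ) : CPGen e n → CPBraid e n
  | .t i => (CPt e n (-i))⁻¹
  | .s k _ _ => (CPs e n k)⁻¹

theorem CPBraidConjGen_lift_CPft (e n : ℕ) (i : ZMod e) :
    FreeGroup.lift (CPBraidConjGen e n) (CPft e n i) = (CPt e n (-i))⁻¹ :=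
  FreeGroup.lift_apply_of

theorem CPBraidConjGen_lift_CPfs (e n k : ℕ) :
    FreeGroup.lift (CPBraidConjGen e n) (CPfs e n k) = (CPs e n k)⁻¹ := by
  by_cases h : 3 ≤ k ∧ k ≤ n
  · rw [CPfs, dif_pos h]
    exact FreeGroup.lift_apply_of
  · rw [CPfs, CPs, dif_neg h, dif_neg h, map_one, inv_one]

theorem CPBraidConjGen_lift_eq_one (e n : ℕ) :
    ∀ r ∈ CPRels e n, FreeGroup.lift (CPBraidConjGen e n) r = 1 := by
  rintro r (⟨i, j, rfl⟩ | ⟨i, rfl⟩ | ⟨i, j, hj, hjn, rfl⟩ | ⟨k, hk, hkn, rfl⟩ |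
    ⟨k, l, hk, hkl, hln, rfl⟩) <;>
  rw [map_mul, map_inv, mul_inv_eq_one] <;>
  simp only [map_mul, CPBraidConjGen_lift_CPft, CPBraidConjGen_lift_CPfs, ← mul_inv_rev,
    inv_inj, ← mul_assoc]
  · have h := CPt_mul_CPt e n (-(i + 1)) (-(j + 1))
    rwa [neg_add, neg_add, neg_add_cancel_right, neg_add_cancel_right, ← neg_add, ← neg_add] at h
  · exact CPs_three_braid_CPt e n (-i)
  · exact (CPt_mul_CPs e n (-i) hj hjn).symm
  · exact CPs_braid_CPs e hk hkn
  · exact (CPs_mul_CPs e hk hkl hln).symm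

/-- Complex conjugation on the braid group of `G(e,e,n)`, as an endomorphism. -/
def CPBraidConj (e n : ℕ) : CPBraid e n →* CPBraid e n :=
  PresentedGroup.toGroup (CPBraidConjGen_lift_eq_one e n)

theorem CPBraidConj_CPt (e n : ℕ) (i : ZMod e) :
    CPBraidConj e n (CPt e n i) = (CPt e n (-i))⁻¹ :=
  PresentedGroup.toGroup.of (CPBraidConjGen_lift_eq_one e n)

theorem CPBraidConj_CPs (e n k : ℕ) :
    CPBraidConj e n (CPs e n k) = (CPs e n k)⁻¹ := by
  by_cases h : 3 ≤ k ∧ k ≤ n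
  · conv_lhs => rw [CPs, dif_pos h]
    exact PresentedGroup.toGroup.of (CPBraidConjGen_lift_eq_one e n)
  · rw [CPs, dif_neg h, map_one, inv_one]

theorem CPBraidConj_comp_self (e n : ℕ) :
    (CPBraidConj e n).comp (CPBraidConj e n) = MonoidHom.id _ := by
  refine PresentedGroup.ext fun x => ?_
  cases x with
  | t i =>
    change CPBraidConj e n (CPBraidConj e n (CPt e n i)) = CPt e n i
    rw [CPBraidConj_CPt, map_inv, CPBraidConj_CPt, neg_neg, inv_inv]
  | s k h₁ h₂ =>
    have hs : PresentedGroup.of (CPGen.s k h₁ h₂) = CPs e n k := by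
      rw [CPs, dif_pos ⟨h₁, h₂⟩]
    rw [hs, MonoidHom.comp_apply, MonoidHom.id_apply, CPBraidConj_CPs, map_inv,
      CPBraidConj_CPs, inv_inv]

/-- For `e ≥ 1` and `n ≥ 3`, the braid group of `G(e,e,n)` with its
Corran–Picantin presentation admits an automorphism `σ` of order two (realizing the
complex conjugation) with `σ(s_k) = s_k⁻¹` for `3 ≤ k ≤ n` and `σ(t_i) = t_{−i}⁻¹`
for all `i ∈ ℤ/eℤ`. -/
theorem CPBraid_conjugation_automorphism (e n : ℕ) (he : 1 ≤ e) (hn : 3 ≤ n) :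
    ∃ σ : CPBraid e n ≃* CPBraid e n,
      (∀ k : ℕ, 3 ≤ k → k ≤ n → σ (CPs e n k) = (CPs e n k)⁻¹) ∧
      (∀ i : ZMod e, σ (CPt e n i) = (CPt e n (-i))⁻¹) ∧
      (∀ g : CPBraid e n, σ (σ g) = g) := by
  exact ⟨(CPBraidConj e n).toMulEquiv (CPBraidConj e n) (CPBraidConj_comp_self e n)
    (CPBraidConj_comp_self e n), fun k _ _ => CPBraidConj_CPs e n k, CPBraidConj_CPt e n,
    DFunLike.congr_fun (CPBraidConj_comp_self e n)⟩
end

section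
/- Let B₁ be the presented group with generators g₁, g₂, g₃ and relations g₁g₂g₃g₁ = g₃g₁g₂g₃ and g₃g₁g₂g₃g₂ = g₂g₃g₁g₂g₃, and let B₂ be the presented group with generators a, b and relation ababab = bababa. Then there exists a group isomorphism ψ : B₂ → B₁ with ψ(a) = g₃g₁g₂g₃ and ψ(b) = g₃⁻¹. -/
/-- Generators `g₁, g₂, g₃` of the braid group of the complex reflection group `G₁₃`. -/
inductive G13Gen : Type
  | g1 : G13Gen
  | g2 : G13Gen
  | g3 : G13Gen

open FreeGroup in
/-- The relators of the presentation
`⟨g₁, g₂, g₃ ∣ g₁g₂g₃g₁ = g₃g₁g₂g₃, g₃g₁g₂g₃g₂ = g₂g₃g₁g₂g₃⟩`. -/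
def G13Rels : Set (FreeGroup G13Gen) :=
  { of .g1 * of .g2 * of .g3 * of .g1 * (of .g3 * of .g1 * of .g2 * of .g3)⁻¹,
    of .g3 * of .g1 * of .g2 * of .g3 * of .g2 *
      (of .g2 * of .g3 * of .g1 * of .g2 * of .g3)⁻¹ }

/-- The braid group of `G₁₃`. -/
abbrev BraidG13 : Type := PresentedGroup G13Rels

/-- Generators `a, b` of the Artin group of dihedral type `I₂(6)`. -/
inductive I26Gen : Type
  | a : I26Gen
  | b : I26Gen

open FreeGroup in
/-- The relator of the presentation `⟨a, b ∣ ababab = bababa⟩`. -/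
def I26Rels : Set (FreeGroup I26Gen) :=
  { of .a * of .b * of .a * of .b * of .a * of .b *
      (of .b * of .a * of .b * of .a * of .b * of .a)⁻¹ }

/-- The Artin group of dihedral type `I₂(6)`. -/
abbrev ArtinI26 : Type := PresentedGroup I26Rels

open PresentedGroup in
theorem ArtinI26.relation :
    (of .a * of .b * of .a * of .b * of .a * of .b : ArtinI26) =
      of .b * of .a * of .b * of .a * of .b * of .a :=
  mul_inv_eq_one.mp (one_of_mem (rels := I26Rels) rfl)

open PresentedGroup in
theorem BraidG13.relation₁ :
    (of .g1 * of .g2 * of .g3 * of .g1 : BraidG13) = of .g3 * of .g1 * of .g2 * of .g3 :=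
  mul_inv_eq_one.mp (one_of_mem (rels := G13Rels) (Or.inl rfl))

open PresentedGroup in
theorem BraidG13.relation₂ :
    (of .g3 * of .g1 * of .g2 * of .g3 * of .g2 : BraidG13) =
      of .g2 * of .g3 * of .g1 * of .g2 * of .g3 :=
  mul_inv_eq_one.mp (one_of_mem (rels := G13Rels) (Or.inr rfl))

section Words

variable {G : Type*} [Group G]

theorem inv_mul_inv_mul_of_braidG13_relation {x y z : G} (h : x * y * z * x = z * x * y * z) :
    (z * x * y * z)⁻¹ * z * (z * x * y * z) = x := by
  calc (z * x * y * z)⁻¹ * z * (z * x * y * z)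
      = (x * y * z)⁻¹ * (z * x * y * z) := by group
    _ = (x * y * z)⁻¹ * (x * y * z * x) := by rw [h]
    _ = x := by group

theorem word_eq_of_braidG13_relation {x y z : G} (h : x * y * z * x = z * x * y * z) :
    (z * x * y * z)⁻¹ * z⁻¹ * (z * x * y * z) * z⁻¹ * (z * x * y * z) * z⁻¹ = y := by
  calc (z * x * y * z)⁻¹ * z⁻¹ * (z * x * y * z) * z⁻¹ * (z * x * y * z) * z⁻¹
      = ((z * x * y * z)⁻¹ * z * (z * x * y * z))⁻¹ * (x * y) := by group
    _ = y := by rw [inv_mul_inv_mul_of_braidG13_relation h]; group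

theorem artinI26_relation_of_braidG13_relations {x y z : G} (h₁ : x * y * z * x = z * x * y * z)
    (h₂ : z * x * y * z * y = y * z * x * y * z) :
    (z * x * y * z) * z⁻¹ * (z * x * y * z) * z⁻¹ * (z * x * y * z) * z⁻¹ =
      z⁻¹ * (z * x * y * z) * z⁻¹ * (z * x * y * z) * z⁻¹ * (z * x * y * z) := by
  have hy := word_eq_of_braidG13_relation h₁
  have h : (z * x * y * z) * y = y * (z * x * y * z) := by simpa only [mul_assoc] using h₂
  generalize z * x * y * z = a at hy h ⊢
  calc a * z⁻¹ * a * z⁻¹ * a * z⁻¹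
      = a * (a * (a⁻¹ * z⁻¹ * a * z⁻¹ * a * z⁻¹)) := by group
    _ = a * (y * a) := by rw [hy, h]
    _ = z⁻¹ * a * z⁻¹ * a * z⁻¹ * a := by rw [← hy]; group

theorem braidG13_relation₂_of_artinI26_relation {a b : G}
    (h : a * b * a * b * a * b = b * a * b * a * b * a) :
    b⁻¹ * (a⁻¹ * b⁻¹ * a) * (a⁻¹ * b * a * b * a * b) * b⁻¹ * (a⁻¹ * b * a * b * a * b) =
      (a⁻¹ * b * a * b * a * b) * b⁻¹ * (a⁻¹ * b⁻¹ * a) * (a⁻¹ * b * a * b * a * b) * b⁻¹ := by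
  calc _ = a⁻¹ * (a * b * a * b * a * b) := by group
    _ = a⁻¹ * (b * a * b * a * b * a) := by rw [h]
    _ = _ := by group

end Words

/-- The homomorphism `ArtinI26 → BraidG13` with `a ↦ g₃g₁g₂g₃` and `b ↦ g₃⁻¹`. -/
def ArtinI26.toBraidG13 : ArtinI26 →* BraidG13 :=
  PresentedGroup.toGroup (rels := I26Rels)
    (f := fun
      | .a => .of .g3 * .of .g1 * .of .g2 * .of .g3
      | .b => (.of .g3)⁻¹) <| by
    rintro _ rfl
    simp only [map_mul, map_inv, FreeGroup.lift_apply_of]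
    exact mul_inv_eq_one.mpr (artinI26_relation_of_braidG13_relations
      BraidG13.relation₁ BraidG13.relation₂)

/-- The homomorphism `BraidG13 → ArtinI26` with `g₁ ↦ a⁻¹b⁻¹a`, `g₂ ↦ a⁻¹babab` and
`g₃ ↦ b⁻¹`. -/
def BraidG13.toArtinI26 : BraidG13 →* ArtinI26 :=
  PresentedGroup.toGroup (rels := G13Rels)
    (f := fun
      | .g1 => (.of .a)⁻¹ * (.of .b)⁻¹ * .of .a
      | .g2 => (.of .a)⁻¹ * .of .b * .of .a * .of .b * .of .a * .of .b
      | .g3 => (.of .b)⁻¹) <| by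
    rintro _ (rfl | rfl) <;> simp only [map_mul, map_inv, FreeGroup.lift_apply_of]
    · group
    · exact mul_inv_eq_one.mpr
        (braidG13_relation₂_of_artinI26_relation ArtinI26.relation)

/-- There is a group isomorphism `ψ : ⟨a, b ∣ ababab = bababa⟩ →
⟨g₁, g₂, g₃ ∣ g₁g₂g₃g₁ = g₃g₁g₂g₃, g₃g₁g₂g₃g₂ = g₂g₃g₁g₂g₃⟩` with
`ψ(a) = g₃g₁g₂g₃` and `ψ(b) = g₃⁻¹`. -/
theorem artinI26_iso_braidG13 :
    ∃ ψ : ArtinI26 ≃* BraidG13,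
      ψ (PresentedGroup.of I26Gen.a) =
        PresentedGroup.of G13Gen.g3 * PresentedGroup.of G13Gen.g1 *
          PresentedGroup.of G13Gen.g2 * PresentedGroup.of G13Gen.g3 ∧
      ψ (PresentedGroup.of I26Gen.b) = (PresentedGroup.of G13Gen.g3)⁻¹ := by
  have h₁ := BraidG13.relation₁
  refine ⟨MonoidHom.toMulEquiv ArtinI26.toBraidG13 BraidG13.toArtinI26 ?_ ?_, ?_, ?_⟩
  · ext (_ | _) <;> simp only [ArtinI26.toBraidG13, BraidG13.toArtinI26, MonoidHom.comp_apply,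
      PresentedGroup.toGroup.of, map_mul, map_inv, MonoidHom.id_apply] <;> group
  · ext (_ | _ | _) <;> simp only [ArtinI26.toBraidG13, BraidG13.toArtinI26,
      MonoidHom.comp_apply, PresentedGroup.toGroup.of, map_mul, map_inv, MonoidHom.id_apply,
      inv_inv]
    · exact inv_mul_inv_mul_of_braidG13_relation h₁
    · exact word_eq_of_braidG13_relation h₁
  · simp only [MonoidHom.toMulEquiv_apply, ArtinI26.toBraidG13, PresentedGroup.toGroup.of]
  · simp only [MonoidHom.toMulEquiv_apply, ArtinI26.toBraidG13, PresentedGroup.toGroup.of]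
end

section
/- Let A be a commutative ring, let C = A[X₁, …, X_k] be a polynomial ring in finitely many variables over A, and let P ∈ C be such that for every prime ideal 𝔓 of A, the image of P in the polynomial ring (A/𝔓)[X₁, …, X_k] is nonzero. Then the localization C[P⁻¹] of C at the multiplicative set of powers of P is a faithfully flat A-algebra. -/
/-- An `A`-algebra `B` obtained by inverting a polynomial `P` over `A` is faithfully flat as soon as
the reduction of `P` modulo every maximal ideal of `A` is nonzero. -/
theorem MvPolynomial.faithfullyFlat_of_isLocalizationAway {A σ B : Type*} [CommRing A] [CommRing B]
    [Algebra A B] [Algebra (MvPolynomial σ A) B] [IsScalarTower A (MvPolynomial σ A) B]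
    (P : MvPolynomial σ A) [IsLocalization.Away P B]
    (hP : ∀ m : Ideal A, m.IsMaximal → MvPolynomial.map (Ideal.Quotient.mk m) P ≠ 0) :
    Module.FaithfullyFlat A B := by
  have : Module.Flat (MvPolynomial σ A) B := IsLocalization.flat B (Submonoid.powers P)
  have : Module.Flat A B := Module.Flat.trans A (MvPolynomial σ A) B
  refine ⟨fun m hm htop => ?_⟩
  let K := FractionRing (MvPolynomial σ (A ⧸ m))
  let g : MvPolynomial σ A →+* K :=
    (algebraMap (MvPolynomial σ (A ⧸ m)) K).comp (MvPolynomial.map (Ideal.Quotient.mk m))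
  have hg : IsUnit (g P) :=
    ((map_ne_zero_iff _ (IsFractionRing.injective (MvPolynomial σ (A ⧸ m)) K)).2 (hP m hm)).isUnit
  let φ : B →+* K := IsLocalization.Away.lift P hg
  have hker : ∀ a ∈ m, φ (algebraMap A B a) = 0 := fun a ha => by
    rw [IsScalarTower.algebraMap_apply A (MvPolynomial σ A) B, IsLocalization.Away.lift_eq]
    simp [g, MvPolynomial.algebraMap_eq, Ideal.Quotient.eq_zero_iff_mem.2 ha]
  have hone : (1 : B) ∈ m • (⊤ : Submodule A B) := by
    rw [htop]; exact Submodule.mem_top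
  have hφ : φ 1 = 0 := by
    refine Submodule.smul_induction_on hone (p := fun x => φ x = 0) (fun a ha b _ => ?_)
      fun x y hx hy => ?_
    · rw [Algebra.smul_def, map_mul, hker a ha, zero_mul]
    · rw [map_add, hx, hy, add_zero]
  exact one_ne_zero ((map_one φ).symm.trans hφ)

/-- Let `A` be a commutative ring, `C = A[X₁, …, X_k]` a polynomial ring
in finitely many variables over `A`, and `P ∈ C` such that for every prime ideal `𝔓` of `A`
the image of `P` in `(A/𝔓)[X₁, …, X_k]` is nonzero. Then the localization `C[P⁻¹]`,
regarded as an `A`-algebra via `A → C → C[P⁻¹]`, is faithfully flat over `A`. -/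
theorem localization_of_polynomial_ring_faithfullyFlat
    (A : Type*) [CommRing A] (k : ℕ) (P : MvPolynomial (Fin k) A)
    (hP : ∀ 𝔓 : Ideal A, 𝔓.IsPrime →
      MvPolynomial.map (Ideal.Quotient.mk 𝔓) P ≠ 0) :
    letI : Algebra A (Localization.Away P) :=
      ((algebraMap (MvPolynomial (Fin k) A) (Localization.Away P)).comp
        (algebraMap A (MvPolynomial (Fin k) A))).toAlgebra
    Module.FaithfullyFlat A (Localization.Away P) := by
  exact MvPolynomial.faithfullyFlat_of_isLocalizationAway P fun m hm => hP m hm.isPrime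
end

section
/- Let ŝ₁ = [[1, −1], [0, −1]] and ŝ₂ = [[−1, 0], [−1, 1]] in GL₂(ℂ), and let W ≤ GL₂(ℂ) be the subgroup they generate (a copy of the symmetric group 𝔖₃ acting as a reflection group on ℂ²). Let W act on the polynomial ring ℂ[z₁, z₂] by linear substitution of the variables. Then the subalgebra ℂ[z₁, z₂]^W of W-invariant polynomials equals the ℂ-subalgebra generated by f₁ = z₁² − z₁z₂ + z₂² and f₂ = z₁³ − (3/2)z₁²z₂ − (3/2)z₁z₂² + z₂³. -/
open MvPolynomial

/-- The action of `g ∈ GL₂(ℂ)` on `ℂ[z₁, z₂]` by substituting for the variables their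
images under the linear map given by `g` : `X i ↦ ∑ j, g i j • X j`. -/
noncomputable def glSubst (g : GL (Fin 2) ℂ) :
    MvPolynomial (Fin 2) ℂ →ₐ[ℂ] MvPolynomial (Fin 2) ℂ :=
  aeval (fun i => ∑ j, C ((g : Matrix (Fin 2) (Fin 2) ℂ) i j) * X j)

theorem glSubst_mul (g h : GL (Fin 2) ℂ) :
    glSubst (g * h) = (glSubst h).comp (glSubst g) := by
  ext1 i
  simp only [glSubst, AlgHom.comp_apply, aeval_X, Units.val_mul, Matrix.mul_apply,
    Fin.sum_univ_two, map_add, map_mul, algHom_C, algebraMap_eq]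
  ring

theorem glSubst_one : glSubst 1 = AlgHom.id ℂ _ := by
  ext1 i
  fin_cases i <;> simp [glSubst]

/-- A polynomial fixed by a set of matrices is fixed by the subgroup they generate. -/
theorem glSubst_eq_self_of_mem_closure {S : Set (GL (Fin 2) ℂ)} {p : MvPolynomial (Fin 2) ℂ}
    (hp : ∀ g ∈ S, glSubst g p = p) {g : GL (Fin 2) ℂ} (hg : g ∈ Subgroup.closure S) :
    glSubst g p = p := by
  induction hg using Subgroup.closure_induction with
  | mem g hg => exact hp g hg
  | one => simp [glSubst_one]
  | mul g h _ _ hg hh => rw [glSubst_mul, AlgHom.comp_apply, hg, hh]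
  | inv g _ hg =>
    have h := DFunLike.congr_fun (glSubst_mul g g⁻¹) p
    rwa [mul_inv_cancel, glSubst_one, AlgHom.comp_apply, hg, AlgHom.id_apply, eq_comm] at h

/-- A polynomial fixed by the adjacent transpositions of the variables is symmetric. -/
theorem isSymmetric_of_rename_swap_castSucc_succ {R : Type*} [CommSemiring R] {n : ℕ}
    {q : MvPolynomial (Fin (n + 1)) R}
    (hq : ∀ i : Fin n, rename (Equiv.swap i.castSucc i.succ) q = q) : q.IsSymmetric := by
  intro e
  have he : e ∈ Submonoid.closure
      (Set.range fun i : Fin n ↦ Equiv.swap i.castSucc i.succ) := by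
    rw [Equiv.Perm.mclosure_swap_castSucc_succ]; trivial
  induction he using Submonoid.closure_induction with
  | mem e he => obtain ⟨i, rfl⟩ := he; exact hq i
  | one => simp
  | mul e f _ _ he hf => rw [Equiv.Perm.coe_mul, ← rename_rename, hf, he]

theorem aeval_mem_of_forall_mem {R A σ : Type*} [CommSemiring R] [CommSemiring A] [Algebra R A]
    {S : Subalgebra R A} {f : σ → A} (hf : ∀ i, f i ∈ S) (r : MvPolynomial σ R) :
    aeval f r ∈ S := by
  have h : (aeval f : MvPolynomial σ R →ₐ[R] A).range ≤ S := by
    rw [← Algebra.adjoin_range_eq_range_aeval, Algebra.adjoin_le_iff]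
    rintro _ ⟨i, rfl⟩
    exact hf i
  exact h ⟨r, rfl⟩

/-- The three linear forms permuted by the reflection group, which sum to zero. -/
noncomputable def rootForms : MvPolynomial (Fin 3) ℂ →ₐ[ℂ] MvPolynomial (Fin 2) ℂ :=
  aeval ![X 0 - C 2 * X 1, X 0 + X 1, X 1 - C 2 * X 0]

/-- The equivariant section of `rootForms`. -/
noncomputable def rootSection : MvPolynomial (Fin 2) ℂ →ₐ[ℂ] MvPolynomial (Fin 3) ℂ :=
  aeval ![C (1/3) * (X 1 - X 2), C (1/3) * (X 1 - X 0)]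

theorem C_third_mul_three {σ : Type*} : (C (1/3) : MvPolynomial σ ℂ) * 3 = 1 := by
  rw [← map_ofNat C 3, ← C_mul]; norm_num

theorem rootForms_rootSection (p : MvPolynomial (Fin 2) ℂ) : rootForms (rootSection p) = p := by
  suffices h : rootForms.comp rootSection = AlgHom.id ℂ _ from DFunLike.congr_fun h p
  have h3 := C_third_mul_three (σ := Fin 2)
  have h2 : (C 2 : MvPolynomial (Fin 2) ℂ) = 2 := map_ofNat C 2
  ext1 i
  fin_cases i
  · simp [rootForms, rootSection, algHom_C, h2, -one_div]
    linear_combination X 0 * h3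
  · simp [rootForms, rootSection, algHom_C, h2, -one_div]
    linear_combination X 1 * h3

theorem rename_swap_zero_one_rootSection {g : GL (Fin 2) ℂ}
    (hg : (g : Matrix (Fin 2) (Fin 2) ℂ) = !![1, -1; 0, -1]) (p : MvPolynomial (Fin 2) ℂ) :
    rename (Equiv.swap 0 1) (rootSection p) = rootSection (glSubst g p) := by
  suffices h : (rename (Equiv.swap 0 1)).comp rootSection = rootSection.comp (glSubst g) from
    DFunLike.congr_fun h p
  have h02 : Equiv.swap (0 : Fin 3) 1 2 = 2 := by decide
  ext1 i
  fin_cases i <;> simp [rootSection, glSubst, hg, algHom_C, -one_div, h02] <;> ring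

theorem rename_swap_one_two_rootSection {g : GL (Fin 2) ℂ}
    (hg : (g : Matrix (Fin 2) (Fin 2) ℂ) = !![-1, 0; -1, 1]) (p : MvPolynomial (Fin 2) ℂ) :
    rename (Equiv.swap 1 2) (rootSection p) = rootSection (glSubst g p) := by
  suffices h : (rename (Equiv.swap 1 2)).comp rootSection = rootSection.comp (glSubst g) from
    DFunLike.congr_fun h p
  have h12 : Equiv.swap (1 : Fin 3) 2 0 = 0 := by decide
  ext1 i
  fin_cases i <;> simp [rootSection, glSubst, hg, algHom_C, -one_div, h12] <;> ring

theorem rootForms_esymm_one : rootForms (esymm (Fin 3) ℂ 1) = 0 := by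
  have h2 : (C 2 : MvPolynomial (Fin 2) ℂ) = 2 := map_ofNat C 2
  simp [esymm_one, Fin.sum_univ_three, rootForms, h2]
  ring

theorem rootForms_esymm_two :
    rootForms (esymm (Fin 3) ℂ 2) = C (-3) * (X 0 ^ 2 - X 0 * X 1 + X 1 ^ 2) := by
  have h2 : (C 2 : MvPolynomial (Fin 2) ℂ) = 2 := map_ofNat C 2
  have h3 : (C 3 : MvPolynomial (Fin 2) ℂ) = 3 := map_ofNat C 3
  have h : (Finset.univ : Finset (Fin 3)).powersetCard 2 = {{0, 1}, {0, 2}, {1, 2}} := by decide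
  rw [esymm, h, Finset.sum_insert (by decide), Finset.sum_insert (by decide),
    Finset.sum_singleton]
  simp [rootForms, h2, h3]
  ring

theorem rootForms_esymm_three :
    rootForms (esymm (Fin 3) ℂ 3) =
      C (-2) * (X 0 ^ 3 - C (3/2) * X 0 ^ 2 * X 1 - C (3/2) * X 0 * X 1 ^ 2 + X 1 ^ 3) := by
  have h2 : (C 2 : MvPolynomial (Fin 2) ℂ) = 2 := map_ofNat C 2
  have h32 : (C (3/2) : MvPolynomial (Fin 2) ℂ) * 2 = 3 := by
    rw [← map_ofNat C 3, ← map_ofNat C 2, ← C_mul]; norm_num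
  have h : (Finset.univ : Finset (Fin 3)).powersetCard 3 = {{0, 1, 2}} := by decide
  rw [esymm, h, Finset.sum_singleton]
  generalize (C (3/2) : MvPolynomial (Fin 2) ℂ) = c at *
  simp [rootForms, h2]
  linear_combination (-(X 0 ^ 2 * X 1) - X 0 * X 1 ^ 2) * h32

/-- Let `ŝ₁ = [[1, −1], [0, −1]]`, `ŝ₂ = [[−1, 0], [−1, 1]]` and let
`W ≤ GL₂(ℂ)` be the subgroup they generate (a copy of `𝔖₃`). Then the `W`-invariant
polynomials in `ℂ[z₁, z₂]` are exactly the elements of the subalgebra generated by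
`f₁ = z₁² − z₁z₂ + z₂²` and `f₂ = z₁³ − (3/2)z₁²z₂ − (3/2)z₁z₂² + z₂³`. -/
theorem invariants_of_S3_reflection_group
    (W : Subgroup (GL (Fin 2) ℂ))
    (hW : W = Subgroup.closure
      {g : GL (Fin 2) ℂ |
        (g : Matrix (Fin 2) (Fin 2) ℂ) = !![1, -1; 0, -1] ∨
        (g : Matrix (Fin 2) (Fin 2) ℂ) = !![-1, 0; -1, 1]}) :
    ∀ p : MvPolynomial (Fin 2) ℂ,
      (∀ g ∈ W, glSubst g p = p) ↔
      p ∈ Algebra.adjoin ℂ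
        ({X 0 ^ 2 - X 0 * X 1 + X 1 ^ 2,
          X 0 ^ 3 - C (3/2 : ℂ) * X 0 ^ 2 * X 1 - C (3/2 : ℂ) * X 0 * X 1 ^ 2 + X 1 ^ 3} :
          Set (MvPolynomial (Fin 2) ℂ)) := by
  subst hW
  intro p
  constructor
  · intro hp
    have hq : (rootSection p).IsSymmetric := by
      refine isSymmetric_of_rename_swap_castSucc_succ fun i ↦ ?_
      fin_cases i
      · let g := Matrix.GeneralLinearGroup.mkOfDetNeZero !![(1 : ℂ), -1; 0, -1] (by simp)
        have hg : (g : Matrix (Fin 2) (Fin 2) ℂ) = !![1, -1; 0, -1] := rfl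
        have h := rename_swap_zero_one_rootSection hg p
        rwa [hp g (Subgroup.subset_closure (Or.inl hg))] at h
      · let g := Matrix.GeneralLinearGroup.mkOfDetNeZero !![(-1 : ℂ), 0; -1, 1] (by simp)
        have hg : (g : Matrix (Fin 2) (Fin 2) ℂ) = !![-1, 0; -1, 1] := rfl
        have h := rename_swap_one_two_rootSection hg p
        rwa [hp g (Subgroup.subset_closure (Or.inr hg))] at h
    obtain ⟨r, hr⟩ := esymmAlgHom_fin_surjective ℂ (le_refl 3) ⟨rootSection p, hq⟩
    replace hr := congrArg Subtype.val hr
    rw [esymmAlgHom_apply] at hr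
    rw [← rootForms_rootSection p, ← show _ = rootSection p from hr, ← AlgHom.comp_apply,
      comp_aeval]
    refine aeval_mem_of_forall_mem (fun i ↦ ?_) r
    fin_cases i
    · exact rootForms_esymm_one ▸ zero_mem _
    · exact rootForms_esymm_two ▸ mul_mem (Subalgebra.algebraMap_mem _ _)
        (Algebra.subset_adjoin (Or.inl rfl))
    · exact rootForms_esymm_three ▸ mul_mem (Subalgebra.algebraMap_mem _ _)
        (Algebra.subset_adjoin (Or.inr rfl))
  · intro hp g hg
    refine glSubst_eq_self_of_mem_closure (fun g hg ↦ ?_) hg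
    suffices h : Algebra.adjoin ℂ _ ≤ AlgHom.equalizer (glSubst g) (AlgHom.id ℂ _) from h hp
    rw [Algebra.adjoin_le_iff]
    have h32 : (C (3/2) : MvPolynomial (Fin 2) ℂ) * 2 = 3 := by
      rw [← map_ofNat C 3, ← map_ofNat C 2, ← C_mul]; norm_num
    rintro _ (rfl | rfl) <;> rcases hg with hg | hg <;>
      simp [glSubst, hg, algHom_C]
    · ring
    · ring
    · linear_combination (X 0 ^ 2 * X 1 - X 0 * X 1 ^ 2 + X 1 ^ 3) * h32
    · linear_combination (X 1 ^ 2 * X 0 - X 1 * X 0 ^ 2 + X 0 ^ 3) * h32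
end

section
/- Let n ≥ 2. Let Art(B_n) be the presented group with generators t, s₂, …, s_n and relations t s₂ t s₂ = s₂ t s₂ t, t s_i = s_i t for i ≥ 3, s_i s_{i+1} s_i = s_{i+1} s_i s_{i+1} for 2 ≤ i ≤ n−1, and s_i s_j = s_j s_i for |i−j| ≥ 2, and let Br_{n+1} be the presented group with generators s₁, …, s_n and relations s_i s_{i+1} s_i = s_{i+1} s_i s_{i+1} and s_i s_j = s_j s_i for |i−j| ≥ 2. Let π : Br_{n+1} → 𝔖_{n+1} be the homomorphism sending s_i to the transposition (i, i+1). Then the assignment t ↦ s₁², s_i ↦ s_i (2 ≤ i ≤ n) defines an injective group homomorphism Art(B_n) → Br_{n+1} whose image is the subgroup Br¹_{n+1} = {b ∈ Br_{n+1} : π(b)(1) = 1}, a subgroup of index n+1 in Br_{n+1}. -/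
/-- Generators of the Artin group `Art(Bₙ)` : `t` and `s_i` for `2 ≤ i ≤ n`. -/
inductive BGen (n : ℕ) : Type
  | t : BGen n
  | s : (i : ℕ) → 2 ≤ i → i ≤ n → BGen n

/-- The generator `s_i` (for `2 ≤ i ≤ n`) as an element of the free group. -/
def Bfs (n i : ℕ) : FreeGroup (BGen n) :=
  if h : 2 ≤ i ∧ i ≤ n then FreeGroup.of (BGen.s i h.1 h.2) else 1

/-- The relators of the Artin group of type `Bₙ` :
`t s₂ t s₂ = s₂ t s₂ t`, `t s_i = s_i t` for `i ≥ 3`,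
`s_i s_{i+1} s_i = s_{i+1} s_i s_{i+1}`, and `s_i s_j = s_j s_i` for `|i−j| ≥ 2`. -/
def BRels (n : ℕ) : Set (FreeGroup (BGen n)) :=
  {r | r = FreeGroup.of BGen.t * Bfs n 2 * FreeGroup.of BGen.t * Bfs n 2 *
          (Bfs n 2 * FreeGroup.of BGen.t * Bfs n 2 * FreeGroup.of BGen.t)⁻¹ ∨
       (∃ i : ℕ, 3 ≤ i ∧ i ≤ n ∧
          r = FreeGroup.of BGen.t * Bfs n i * (Bfs n i * FreeGroup.of BGen.t)⁻¹) ∨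
       (∃ i : ℕ, 2 ≤ i ∧ i + 1 ≤ n ∧
          r = Bfs n i * Bfs n (i + 1) * Bfs n i *
            (Bfs n (i + 1) * Bfs n i * Bfs n (i + 1))⁻¹) ∨
       (∃ i j : ℕ, 2 ≤ i ∧ i + 2 ≤ j ∧ j ≤ n ∧
          r = Bfs n i * Bfs n j * (Bfs n j * Bfs n i)⁻¹)}

/-- The Artin group of Coxeter type `Bₙ`. -/
abbrev ArtinB (n : ℕ) : Type := PresentedGroup (BRels n)

/-- The generator `t` of `Art(Bₙ)`. -/
def Bt (n : ℕ) : ArtinB n := PresentedGroup.of BGen.t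

/-- The generator `s_i` (`2 ≤ i ≤ n`) of `Art(Bₙ)`. -/
def Bs (n i : ℕ) : ArtinB n :=
  if h : 2 ≤ i ∧ i ≤ n then PresentedGroup.of (BGen.s i h.1 h.2) else 1

/-- Generators `s_i` (`1 ≤ i ≤ n`) of the braid group `Br_{n+1}` on `n+1` strands. -/
inductive BrGen (n : ℕ) : Type
  | s : (i : ℕ) → 1 ≤ i → i ≤ n → BrGen n

/-- The generator `s_i` (for `1 ≤ i ≤ n`) as an element of the free group. -/
def Brfs (n i : ℕ) : FreeGroup (BrGen n) :=
  if h : 1 ≤ i ∧ i ≤ n then FreeGroup.of (BrGen.s i h.1 h.2) else 1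

/-- The relators of the standard Artin presentation of the braid group `Br_{n+1}` :
`s_i s_{i+1} s_i = s_{i+1} s_i s_{i+1}` and `s_i s_j = s_j s_i` for `|i−j| ≥ 2`. -/
def BrRels (n : ℕ) : Set (FreeGroup (BrGen n)) :=
  {r | (∃ i : ℕ, 1 ≤ i ∧ i + 1 ≤ n ∧
          r = Brfs n i * Brfs n (i + 1) * Brfs n i *
            (Brfs n (i + 1) * Brfs n i * Brfs n (i + 1))⁻¹) ∨
       (∃ i j : ℕ, 1 ≤ i ∧ i + 2 ≤ j ∧ j ≤ n ∧
          r = Brfs n i * Brfs n j * (Brfs n j * Brfs n i)⁻¹)}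

/-- The braid group `Br_{n+1}` on `n+1` strands. -/
abbrev Braid (n : ℕ) : Type := PresentedGroup (BrRels n)

/-- The generator `s_i` (`1 ≤ i ≤ n`) of `Br_{n+1}`. -/
def Brs (n i : ℕ) : Braid n :=
  if h : 1 ≤ i ∧ i ≤ n then PresentedGroup.of (BrGen.s i h.1 h.2) else 1

section GroupIdentities

variable {G : Type*} [Group G]

/-- If `a` and `p` satisfy the length-four braid relation, `p` and `q` the length-three one, and
`a` commutes with `q`, then `p * a * p⁻¹` and `q` satisfy the length-four braid relation. -/
theorem length_four_relation_conj {a p q : G} (hap : a * p * a * p = p * a * p * a)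
    (hpq : p * q * p = q * p * q) (haq : a * q = q * a) :
    p * a * p⁻¹ * q * (p * a * p⁻¹) * q = q * (p * a * p⁻¹) * q * (p * a * p⁻¹) := by
  have hb : p * a * p⁻¹ = p * q * a * (p * q)⁻¹ := by
    rw [mul_assoc p q a, ← haq]; group
  have hq : q = p * q * p * (p * q)⁻¹ := by rw [hpq]; group
  have h := congrArg (fun x => p * q * x * (p * q)⁻¹) hap
  have h1 : p * a * p⁻¹ * q * (p * a * p⁻¹) * q = p * q * (a * p * a * p) * (p * q)⁻¹ := by
    rw [hb]; conv_lhs => enter [2]; rw [hq]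
    conv_lhs => enter [1, 1, 2]; rw [hq]
    group
  have h2 : q * (p * a * p⁻¹) * q * (p * a * p⁻¹) = p * q * (p * a * p * a) * (p * q)⁻¹ := by
    rw [hb]; conv_lhs => enter [1, 2]; rw [hq]
    conv_lhs => enter [1, 1, 1]; rw [hq]
    group
  rw [h1, h2, hap]

/-- The element `p` commutes with `q * p * a * p⁻¹ * q⁻¹` if `p`, `q` satisfy the braid relation
and `q` commutes with `a`. -/
theorem commute_conj_conj {a p q : G} (hpq : p * q * p = q * p * q) (haq : a * q = q * a) :
    p * (q * (p * a * p⁻¹) * q⁻¹) = q * (p * a * p⁻¹) * q⁻¹ * p := by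
  calc p * (q * (p * a * p⁻¹) * q⁻¹) = p * q * p * a * (q * p)⁻¹ := by group
    _ = q * p * (a * q) * (q * p)⁻¹ := by rw [hpq, haq]; group
    _ = q * p * a * (q * p)⁻¹ * (q * p * q) * (q * p)⁻¹ := by group
    _ = q * (p * a * p⁻¹) * q⁻¹ * p := by rw [← hpq]; group

/-- The square of one braid generator and the other generator satisfy the length-four braid
relation. -/
theorem length_four_relation_sq {p q : G} (hpq : p * q * p = q * p * q) :
    p ^ 2 * q * p ^ 2 * q = q * p ^ 2 * q * p ^ 2 := by
  have h1 : p ^ 2 * q * p ^ 2 * q = p * (p * q * p) * (p * q) := by simp only [sq, mul_assoc]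
  have h2 : q * p ^ 2 * q * p ^ 2 = q * p * (p * q * p) * p := by simp only [sq, mul_assoc]
  rw [h1, h2, hpq, show p * (q * p * q) * (p * q) = p * q * p * (q * p * q) by group,
    show q * p * (q * p * q) * p = q * p * q * (p * q * p) by group, hpq]

end GroupIdentities

section BraidRelations

variable {n : ℕ}

theorem Brs_braid {i : ℕ} (h₁ : 1 ≤ i) (h₂ : i + 1 ≤ n) :
    Brs n i * Brs n (i + 1) * Brs n i = Brs n (i + 1) * Brs n i * Brs n (i + 1) := by
  have h := PresentedGroup.one_of_mem (rels := BrRels n) (Or.inl ⟨i, h₁, h₂, rfl⟩)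
  simpa [Brfs, Brs, PresentedGroup.of, mul_inv_eq_one, h₁, h₂, show i ≤ n by omega,
    -mul_inv_rev] using h

theorem Brs_comm {i j : ℕ} (h₁ : 1 ≤ i) (h₂ : i + 2 ≤ j) (h₃ : j ≤ n) :
    Brs n i * Brs n j = Brs n j * Brs n i := by
  have h := PresentedGroup.one_of_mem (rels := BrRels n) (Or.inr ⟨i, j, h₁, h₂, h₃, rfl⟩)
  simpa [Brfs, Brs, PresentedGroup.of, mul_inv_eq_one, h₁, h₃, show i ≤ n by omega,
    show 1 ≤ j by omega, -mul_inv_rev] using h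

theorem Bt_Bs_two (hn : 2 ≤ n) :
    Bt n * Bs n 2 * Bt n * Bs n 2 = Bs n 2 * Bt n * Bs n 2 * Bt n := by
  have h := PresentedGroup.one_of_mem (rels := BRels n) (Or.inl rfl)
  simpa [Bfs, Bs, Bt, PresentedGroup.of, mul_inv_eq_one, hn, -mul_inv_rev] using h

theorem Bt_Bs_comm {i : ℕ} (h₁ : 3 ≤ i) (h₂ : i ≤ n) : Bt n * Bs n i = Bs n i * Bt n := by
  have h := PresentedGroup.one_of_mem (rels := BRels n) (Or.inr (Or.inl ⟨i, h₁, h₂, rfl⟩))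
  simpa [Bfs, Bs, Bt, PresentedGroup.of, mul_inv_eq_one, h₂, show 2 ≤ i by omega,
    -mul_inv_rev] using h

theorem Bs_braid {i : ℕ} (h₁ : 2 ≤ i) (h₂ : i + 1 ≤ n) :
    Bs n i * Bs n (i + 1) * Bs n i = Bs n (i + 1) * Bs n i * Bs n (i + 1) := by
  have h := PresentedGroup.one_of_mem (rels := BRels n)
    (Or.inr (Or.inr (Or.inl ⟨i, h₁, h₂, rfl⟩)))
  simpa [Bfs, Bs, PresentedGroup.of, mul_inv_eq_one, h₁, h₂, show i ≤ n by omega,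
    show 2 ≤ i + 1 by omega, -mul_inv_rev] using h

theorem Bs_comm {i j : ℕ} (h₁ : 2 ≤ i) (h₂ : i + 2 ≤ j) (h₃ : j ≤ n) :
    Bs n i * Bs n j = Bs n j * Bs n i := by
  have h := PresentedGroup.one_of_mem (rels := BRels n)
    (Or.inr (Or.inr (Or.inr ⟨i, j, h₁, h₂, h₃, rfl⟩)))
  simpa [Bfs, Bs, PresentedGroup.of, mul_inv_eq_one, h₁, h₃, show i ≤ n by omega,
    show 2 ≤ j by omega, -mul_inv_rev] using h

variable {G : Type*} [Group G]

/-- Elements satisfying the relations of the braid group define a homomorphism. -/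
theorem Braid.exists_hom (σ : ℕ → G)
    (hbraid : ∀ i, 1 ≤ i → i + 1 ≤ n → σ i * σ (i + 1) * σ i = σ (i + 1) * σ i * σ (i + 1))
    (hcomm : ∀ i j, 1 ≤ i → i + 2 ≤ j → j ≤ n → σ i * σ j = σ j * σ i) :
    ∃ f : Braid n →* G, ∀ i, 1 ≤ i → i ≤ n → f (Brs n i) = σ i := by
  let v : BrGen n → G := fun | .s i _ _ => σ i
  have hv : ∀ i, 1 ≤ i → i ≤ n → FreeGroup.lift v (Brfs n i) = σ i := by
    intro i h₁ h₂; simp [Brfs, h₁, h₂, v]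
  have hrel : ∀ r ∈ BrRels n, FreeGroup.lift v r = 1 := by
    rintro r (⟨i, h₁, h₂, rfl⟩ | ⟨i, j, h₁, h₂, h₃, rfl⟩)
    · rw [map_mul, map_inv, mul_inv_eq_one]
      simp only [map_mul]
      rw [hv i h₁ (by omega), hv (i + 1) (by omega) h₂, hbraid i h₁ h₂]
    · rw [map_mul, map_inv, mul_inv_eq_one]
      simp only [map_mul]
      rw [hv i h₁ (by omega), hv j (by omega) h₃, hcomm i j h₁ h₂ h₃]
  refine ⟨PresentedGroup.toGroup hrel, fun i h₁ h₂ => ?_⟩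
  simp [Brs, h₁, h₂, v]

/-- Elements satisfying the relations of the Artin group of type `B` define a homomorphism. -/
theorem ArtinB.exists_hom (hn : 2 ≤ n) (τ : G) (σ : ℕ → G)
    (hfour : τ * σ 2 * τ * σ 2 = σ 2 * τ * σ 2 * τ)
    (hτ : ∀ i, 3 ≤ i → i ≤ n → τ * σ i = σ i * τ)
    (hbraid : ∀ i, 2 ≤ i → i + 1 ≤ n → σ i * σ (i + 1) * σ i = σ (i + 1) * σ i * σ (i + 1))
    (hcomm : ∀ i j, 2 ≤ i → i + 2 ≤ j → j ≤ n → σ i * σ j = σ j * σ i) :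
    ∃ f : ArtinB n →* G, f (Bt n) = τ ∧ ∀ i, 2 ≤ i → i ≤ n → f (Bs n i) = σ i := by
  let v : BGen n → G := fun | .t => τ | .s i _ _ => σ i
  have hv : ∀ i, 2 ≤ i → i ≤ n → FreeGroup.lift v (Bfs n i) = σ i := by
    intro i h₁ h₂; simp [Bfs, h₁, h₂, v]
  have hvt : FreeGroup.lift v (FreeGroup.of BGen.t) = τ := by simp [v]
  have hrel : ∀ r ∈ BRels n, FreeGroup.lift v r = 1 := by
    rintro r (rfl | ⟨i, h₁, h₂, rfl⟩ | ⟨i, h₁, h₂, rfl⟩ | ⟨i, j, h₁, h₂, h₃, rfl⟩) <;>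
      rw [map_mul, map_inv, mul_inv_eq_one] <;> simp only [map_mul]
    · rw [hv 2 le_rfl hn, hvt, hfour]
    · rw [hv i (by omega) h₂, hvt, hτ i h₁ h₂]
    · rw [hv i h₁ (by omega), hv (i + 1) (by omega) h₂, hbraid i h₁ h₂]
    · rw [hv i h₁ (by omega), hv j (by omega) h₃, hcomm i j h₁ h₂ h₃]
  refine ⟨PresentedGroup.toGroup hrel, by simp [Bt, v], fun i h₁ h₂ => ?_⟩
  simp [Bs, h₁, h₂, v]

theorem ArtinB.closure_generators :
    Subgroup.closure ({Bt n} ∪ {g | ∃ i, 2 ≤ i ∧ i ≤ n ∧ g = Bs n i}) = ⊤ := by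
  rw [eq_top_iff, ← PresentedGroup.closure_range_of, Subgroup.closure_le]
  rintro _ ⟨_ | ⟨i, h₁, h₂⟩, rfl⟩
  · exact Subgroup.subset_closure (Or.inl rfl)
  · exact Subgroup.subset_closure (Or.inr ⟨i, h₁, h₂, by simp [Bs, h₁, h₂]⟩)

theorem Braid.closure_generators :
    Subgroup.closure {g | ∃ i, 1 ≤ i ∧ i ≤ n ∧ g = Brs n i} = ⊤ := by
  rw [eq_top_iff, ← PresentedGroup.closure_range_of, Subgroup.closure_le]
  rintro _ ⟨⟨i, h₁, h₂⟩, rfl⟩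
  exact Subgroup.subset_closure ⟨i, h₁, h₂, by simp [Brs, h₁, h₂]⟩

end BraidRelations

/-- The conjugate `s_{k+1} ⋯ s₂ t s₂⁻¹ ⋯ s_{k+1}⁻¹` in `Art(Bₙ)`. -/
def Btconj (n : ℕ) : ℕ → ArtinB n
  | 0 => Bt n
  | k + 1 => Bs n (k + 2) * Btconj n k * (Bs n (k + 2))⁻¹

section Btconj

variable {n : ℕ}

theorem Btconj_comm_of_gt (k : ℕ) {j : ℕ} (h₁ : k + 3 ≤ j) (h₂ : j ≤ n) :
    Btconj n k * Bs n j = Bs n j * Btconj n k := by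
  induction k with
  | zero => exact Bt_Bs_comm h₁ h₂
  | succ k ih =>
    have hs : Commute (Bs n (k + 2)) (Bs n j) := Bs_comm (by omega) (by omega) h₂
    have ha : Commute (Btconj n k) (Bs n j) := ih (by omega)
    exact ((hs.mul_left ha).mul_left hs.inv_left).eq

theorem Btconj_comm_of_le (k : ℕ) {j : ℕ} (h₁ : 2 ≤ j) (h₂ : j ≤ k) (h₃ : k + 1 ≤ n) :
    Bs n j * Btconj n k = Btconj n k * Bs n j := by
  induction k with
  | zero => omega
  | succ k ih =>
    rcases Nat.lt_or_ge j (k + 1) with hj | hj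
    · have hs : Commute (Bs n j) (Bs n (k + 2)) := Bs_comm h₁ (by omega) h₃
      have ha : Commute (Bs n j) (Btconj n k) := ih (by omega) (by omega)
      exact ((hs.mul_right ha).mul_right hs.inv_right).eq
    · obtain ⟨k, rfl⟩ : ∃ m, k = m + 1 := ⟨k - 1, by omega⟩
      obtain rfl : j = k + 2 := by omega
      exact commute_conj_conj (Bs_braid h₁ h₃) (Btconj_comm_of_gt k le_rfl h₃)

theorem Btconj_length_four (k : ℕ) (h : k + 2 ≤ n) :
    Btconj n k * Bs n (k + 2) * Btconj n k * Bs n (k + 2) =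
      Bs n (k + 2) * Btconj n k * Bs n (k + 2) * Btconj n k := by
  induction k with
  | zero => exact Bt_Bs_two h
  | succ k ih =>
    exact length_four_relation_conj (ih (by omega)) (Bs_braid (by omega) h)
      (Btconj_comm_of_gt k le_rfl h)

end Btconj

/-- The cocycle describing left multiplication by `s_i` on the coset represented by
`s_k ⋯ s₁`: it is the element `c` of `Art(Bₙ)` with `s_i (s_k ⋯ s₁) = (s_{k'} ⋯ s₁) c`, where `k'`
is the image of `k` under the transposition `(i - 1, i)`. -/
def cosetCocycle (n i k : ℕ) : ArtinB n :=
  if n < k then 1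
  else if k + 1 = i then 1
  else if k = i then Btconj n (k - 1)
  else if i < k then Bs n (i + 1)
  else Bs n i

/-- The permutation of `ℕ × Art(Bₙ)` by which `s_i` acts. -/
def cosetPerm (n i : ℕ) : Equiv.Perm (ℕ × ArtinB n) :=
  Equiv.prodShear (Equiv.swap (i - 1) i) fun k => Equiv.mulLeft (cosetCocycle n i k)

/-- The representative `s_k ⋯ s₁` of a coset of the stabilizer of the first strand. -/
def cosetRep (n : ℕ) : ℕ → Braid n
  | 0 => 1
  | k + 1 => Brs n (k + 1) * cosetRep n k

section CosetAction

variable {n : ℕ}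

theorem cosetPerm_apply (n i k : ℕ) (g : ArtinB n) :
    cosetPerm n i (k, g) = (Equiv.swap (i - 1) i k, cosetCocycle n i k * g) := rfl

theorem cosetPerm_of_gt {i k : ℕ} (h : n < k) (hi : i ≤ n) (g : ArtinB n) :
    cosetPerm n i (k, g) = (k, g) := by
  rw [cosetPerm_apply, Equiv.swap_apply_of_ne_of_ne (by omega) (by omega)]
  simp [cosetCocycle, h]

theorem cosetPerm_pred (k : ℕ) (g : ArtinB n) :
    cosetPerm n (k + 1) (k, g) = (k + 1, g) := by
  rw [cosetPerm_apply]
  simp [cosetCocycle]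

theorem cosetPerm_self {k : ℕ} (h : k + 1 ≤ n) (g : ArtinB n) :
    cosetPerm n (k + 1) (k + 1, g) = (k, Btconj n k * g) := by
  rw [cosetPerm_apply]
  simp [cosetCocycle, show ¬ n < k + 1 by omega]

theorem cosetPerm_of_lt {i k : ℕ} (h : i < k) (hk : k ≤ n) (g : ArtinB n) :
    cosetPerm n i (k, g) = (k, Bs n (i + 1) * g) := by
  rw [cosetPerm_apply, Equiv.swap_apply_of_ne_of_ne (by omega) (by omega)]
  simp [cosetCocycle, show ¬ n < k by omega, show ¬ k + 1 = i by omega, show ¬ k = i by omega, h]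

theorem cosetPerm_of_succ_lt {i k : ℕ} (h : k + 1 < i) (hi : i ≤ n) (g : ArtinB n) :
    cosetPerm n i (k, g) = (k, Bs n i * g) := by
  rw [cosetPerm_apply, Equiv.swap_apply_of_ne_of_ne (by omega) (by omega)]
  simp [cosetCocycle, show ¬ n < k by omega, show ¬ k + 1 = i by omega, show ¬ k = i by omega,
    show ¬ i < k by omega]

theorem cosetPerm_comm {i j : ℕ} (h₁ : 1 ≤ i) (h₂ : i + 2 ≤ j) (h₃ : j ≤ n) :
    cosetPerm n i * cosetPerm n j = cosetPerm n j * cosetPerm n i := by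
  obtain ⟨i, rfl⟩ : ∃ m, i = m + 1 := ⟨i - 1, by omega⟩
  obtain ⟨j, rfl⟩ : ∃ m, j = m + 1 := ⟨j - 1, by omega⟩
  ext1 ⟨k, g⟩
  simp only [Equiv.Perm.mul_apply]
  rcases lt_or_ge n k with hk | hk
  · rw [cosetPerm_of_gt hk h₃, cosetPerm_of_gt hk (by omega), cosetPerm_of_gt hk h₃]
  have : k < i ∨ k = i ∨ k = i + 1 ∨ (i + 1 < k ∧ k < j) ∨ k = j ∨ k = j + 1 ∨ j + 1 < k := by
    omega
  rcases this with h | rfl | rfl | ⟨h, h'⟩ | rfl | rfl | h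
  · simp only [cosetPerm_of_succ_lt (show k + 1 < i + 1 by omega) (show i + 1 ≤ n by omega),
      cosetPerm_of_succ_lt (show k + 1 < j + 1 by omega) h₃, ← mul_assoc]
    rw [Bs_comm (by omega) h₂ h₃]
  · rw [cosetPerm_of_succ_lt (by omega) h₃, cosetPerm_pred k, cosetPerm_pred k,
      cosetPerm_of_succ_lt (by omega) h₃]
  · rw [cosetPerm_of_succ_lt (by omega) h₃, cosetPerm_self (by omega), cosetPerm_self (by omega),
      cosetPerm_of_succ_lt (by omega) h₃, ← mul_assoc, ← mul_assoc,
      Btconj_comm_of_gt i (by omega) h₃]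
  · rw [cosetPerm_of_succ_lt (by omega) h₃, cosetPerm_of_lt h hk, cosetPerm_of_lt h hk,
      cosetPerm_of_succ_lt (by omega) h₃, ← mul_assoc, ← mul_assoc,
      Bs_comm (by omega) (by omega) h₃]
  · rw [cosetPerm_pred k, cosetPerm_of_lt (by omega) h₃, cosetPerm_of_lt (by omega) hk,
      cosetPerm_pred k]
  · rw [cosetPerm_self h₃, cosetPerm_of_lt (by omega) (by omega),
      cosetPerm_of_lt (by omega) h₃, cosetPerm_self h₃, ← mul_assoc, ← mul_assoc,
      Btconj_comm_of_le j (by omega) (by omega) h₃]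
  · rw [cosetPerm_of_lt h hk, cosetPerm_of_lt (by omega) hk, cosetPerm_of_lt (by omega) hk,
      cosetPerm_of_lt h hk, ← mul_assoc, ← mul_assoc, Bs_comm (by omega) (by omega) (by omega)]

theorem cosetPerm_braid {i : ℕ} (h₁ : 1 ≤ i) (h₂ : i + 1 ≤ n) :
    cosetPerm n i * cosetPerm n (i + 1) * cosetPerm n i =
      cosetPerm n (i + 1) * cosetPerm n i * cosetPerm n (i + 1) := by
  obtain ⟨i, rfl⟩ : ∃ m, i = m + 1 := ⟨i - 1, by omega⟩
  ext1 ⟨k, g⟩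
  simp only [Equiv.Perm.mul_apply]
  rcases lt_or_ge n k with hk | hk
  · simp only [cosetPerm_of_gt hk h₂, cosetPerm_of_gt hk (show i + 1 ≤ n by omega)]
  have : k < i ∨ k = i ∨ k = i + 1 ∨ k = i + 1 + 1 ∨ i + 1 + 1 < k := by omega
  rcases this with h | rfl | rfl | rfl | h
  · simp only [cosetPerm_of_succ_lt (show k + 1 < i + 1 by omega) (show i + 1 ≤ n by omega),
      cosetPerm_of_succ_lt (show k + 1 < i + 1 + 1 by omega) h₂, ← mul_assoc]
    rw [Bs_braid (by omega) h₂]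
  · simp only [cosetPerm_pred,
      cosetPerm_of_lt (Nat.lt_succ_self (k + 1)) h₂,
      cosetPerm_of_succ_lt (Nat.lt_succ_self (k + 1)) h₂]
  · rw [cosetPerm_self hk, cosetPerm_of_succ_lt (by omega) h₂, cosetPerm_pred i,
      cosetPerm_pred (i + 1), cosetPerm_of_lt (by omega) h₂, cosetPerm_self h₂]
    simp [Btconj, mul_assoc]
  · simp only [cosetPerm_of_lt (Nat.lt_succ_self (i + 1)) h₂, cosetPerm_self h₂,
      cosetPerm_self (show i + 1 ≤ n by omega),
      cosetPerm_of_succ_lt (Nat.lt_succ_self (i + 1)) h₂]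
    congr 1
    have h := Btconj_length_four i h₂
    calc Btconj n i * (Btconj n (i + 1) * (Bs n (i + 1 + 1) * g))
        = Btconj n i * Bs n (i + 2) * Btconj n i * Bs n (i + 2) * (Bs n (i + 2))⁻¹ * g := by
          simp [Btconj, mul_assoc]
      _ = Bs n (i + 1 + 1) * (Btconj n i * (Btconj n (i + 1) * g)) := by
          rw [h]; simp [Btconj, mul_assoc]
  · simp only [cosetPerm_of_lt (show i + 1 < k by omega) hk, cosetPerm_of_lt h hk, ← mul_assoc]
    rw [Bs_braid (by omega) (by omega)]

theorem cosetRep_comm_of_gt (k : ℕ) {i : ℕ} (h₁ : k + 1 < i) (h₂ : i ≤ n) :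
    Commute (Brs n i) (cosetRep n k) := by
  induction k with
  | zero => exact Commute.one_right _
  | succ k ih =>
    have hs : Commute (Brs n (k + 1)) (Brs n i) := Brs_comm (by omega) (by omega) h₂
    exact hs.symm.mul_right (ih (by omega))

theorem Brs_mul_cosetRep_of_lt (k : ℕ) {i : ℕ} (h₁ : 1 ≤ i) (h₂ : i < k) (h₃ : k ≤ n) :
    Brs n i * cosetRep n k = cosetRep n k * Brs n (i + 1) := by
  induction k with
  | zero => omega
  | succ k ih =>
    rcases Nat.lt_or_ge i k with h | h
    · rw [cosetRep, ← mul_assoc, Brs_comm h₁ (by omega) h₃, mul_assoc, ih h (by omega), mul_assoc]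
    · obtain rfl : i = k := by omega
      obtain ⟨i, rfl⟩ : ∃ m, i = m + 1 := ⟨i - 1, by omega⟩
      rw [cosetRep, cosetRep, mul_assoc, mul_assoc,
        ← (cosetRep_comm_of_gt i (show i + 1 < i + 1 + 1 by omega) h₃).eq]
      simp only [← mul_assoc]
      rw [Brs_braid h₁ h₃]

variable {Φ : ArtinB n →* Braid n}

theorem cosetRep_mul_map_Btconj (hΦt : Φ (Bt n) = Brs n 1 ^ 2)
    (hΦs : ∀ i : ℕ, 2 ≤ i → i ≤ n → Φ (Bs n i) = Brs n i) (k : ℕ) (h : k + 1 ≤ n) :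
    Brs n (k + 1) * Brs n (k + 1) * cosetRep n k = cosetRep n k * Φ (Btconj n k) := by
  induction k with
  | zero => simp [cosetRep, Btconj, hΦt, sq]
  | succ k ih =>
    have hc := cosetRep_comm_of_gt k (show k + 1 < k + 2 by omega) h
    have hb : Brs n (k + 1) * Brs n (k + 2) * Brs n (k + 1) =
        Brs n (k + 2) * Brs n (k + 1) * Brs n (k + 2) := Brs_braid (by omega) h
    have ih := ih (by omega)
    symm
    calc cosetRep n (k + 1) * Φ (Btconj n (k + 1))
        = Brs n (k + 1) * (cosetRep n k * Brs n (k + 2)) * Φ (Btconj n k) * (Brs n (k + 2))⁻¹ := by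
          simp only [cosetRep, Btconj, map_mul, map_inv, hΦs (k + 2) (by omega) h, mul_assoc]
      _ = Brs n (k + 1) * Brs n (k + 2) * (cosetRep n k * Φ (Btconj n k)) * (Brs n (k + 2))⁻¹ := by
          rw [← hc.eq]; simp only [mul_assoc]
      _ = Brs n (k + 1) * Brs n (k + 2) * Brs n (k + 1) * Brs n (k + 1) *
            (cosetRep n k * (Brs n (k + 2))⁻¹) := by
          rw [← ih]; simp only [mul_assoc]
      _ = Brs n (k + 2) * (Brs n (k + 1) * Brs n (k + 2) * Brs n (k + 1)) *
            (Brs n (k + 2))⁻¹ * cosetRep n k := by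
          rw [← hc.inv_left.eq]
          simpa only [mul_assoc] using
            congrArg (· * (Brs n (k + 1) * ((Brs n (k + 2))⁻¹ * cosetRep n k))) hb
      _ = Brs n (k + 1 + 1) * Brs n (k + 1 + 1) * cosetRep n (k + 1) := by
          rw [hb]; simp [cosetRep, mul_assoc]

/-- The map `(k, g) ↦ (s_k ⋯ s₁) Φ(g)` intertwines the action of `s_i` with left
multiplication. -/
theorem Brs_mul_cosetRep (hΦt : Φ (Bt n) = Brs n 1 ^ 2)
    (hΦs : ∀ i : ℕ, 2 ≤ i → i ≤ n → Φ (Bs n i) = Brs n i) {i k : ℕ} (h₁ : 1 ≤ i) (h₂ : i ≤ n)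
    (hk : k ≤ n) (g : ArtinB n) :
    (cosetPerm n i (k, g)).1 ≤ n ∧ Brs n i * (cosetRep n k * Φ g) =
      cosetRep n (cosetPerm n i (k, g)).1 * Φ (cosetPerm n i (k, g)).2 := by
  obtain ⟨i, rfl⟩ : ∃ m, i = m + 1 := ⟨i - 1, by omega⟩
  have : k < i ∨ k = i ∨ k = i + 1 ∨ i + 1 < k := by omega
  rcases this with h | rfl | rfl | h
  · rw [cosetPerm_of_succ_lt (by omega) h₂]
    refine ⟨hk, ?_⟩
    rw [map_mul, hΦs _ (by omega) h₂, ← mul_assoc, ← mul_assoc,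
      (cosetRep_comm_of_gt k (by omega) h₂).eq]
  · rw [cosetPerm_pred k]
    exact ⟨h₂, by rw [cosetRep, mul_assoc]⟩
  · rw [cosetPerm_self h₂]
    refine ⟨by dsimp only; omega, ?_⟩
    rw [map_mul, ← mul_assoc (cosetRep n i), ← cosetRep_mul_map_Btconj hΦt hΦs i h₂, cosetRep]
    simp only [mul_assoc]
  · rw [cosetPerm_of_lt h hk]
    refine ⟨hk, ?_⟩
    rw [map_mul, hΦs _ (by omega) (by omega), ← mul_assoc, ← mul_assoc,
      Brs_mul_cosetRep_of_lt k h₁ h hk]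

/-- Every braid lies in the coset of one of the representatives. -/
theorem exists_eq_cosetRep_mul (hΦt : Φ (Bt n) = Brs n 1 ^ 2)
    (hΦs : ∀ i : ℕ, 2 ≤ i → i ≤ n → Φ (Bs n i) = Brs n i) (b : Braid n) :
    ∃ k ≤ n, ∃ g, b = cosetRep n k * Φ g := by
  have hb : b ∈ Subgroup.closure {g | ∃ i, 1 ≤ i ∧ i ≤ n ∧ g = Brs n i} := by
    rw [Braid.closure_generators]; trivial
  induction hb using Subgroup.closure_induction_left with
  | one => exact ⟨0, by omega, 1, by simp [cosetRep]⟩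
  | mul_left x hx y hy ih =>
    obtain ⟨i, h₁, h₂, rfl⟩ := hx
    obtain ⟨k, hk, g, rfl⟩ := ih
    obtain ⟨h, h'⟩ := Brs_mul_cosetRep hΦt hΦs h₁ h₂ hk g
    exact ⟨_, h, _, h'⟩
  | inv_mul_cancel x hx y hy ih =>
    obtain ⟨i, h₁, h₂, rfl⟩ := hx
    obtain ⟨k, hk, g, rfl⟩ := ih
    obtain ⟨⟨k', g'⟩, hkg⟩ := (cosetPerm n i).surjective (k, g)
    have hk' : k' ≤ n := by
      by_contra! hlt
      rw [cosetPerm_of_gt hlt h₂, Prod.mk.injEq] at hkg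
      omega
    refine ⟨k', hk', g', ?_⟩
    rw [inv_mul_eq_iff_eq_mul, (Brs_mul_cosetRep hΦt hΦs h₁ h₂ hk' g').2, hkg]

theorem injective_of_map_generators (hΦt : Φ (Bt n) = Brs n 1 ^ 2)
    (hΦs : ∀ i : ℕ, 2 ≤ i → i ≤ n → Φ (Bs n i) = Brs n i) (hn : 1 ≤ n) :
    Function.Injective Φ := by
  obtain ⟨ρ, hρ⟩ := Braid.exists_hom (n := n) (cosetPerm n) (fun _ => cosetPerm_braid)
    (fun _ _ => cosetPerm_comm)
  have key : ∀ g h : ArtinB n, ρ (Φ g) (0, h) = (0, g * h) := by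
    intro g
    have hg : g ∈ Subgroup.closure ({Bt n} ∪ {g | ∃ i, 2 ≤ i ∧ i ≤ n ∧ g = Bs n i}) := by
      rw [ArtinB.closure_generators]; trivial
    induction hg using Subgroup.closure_induction with
    | mem x hx =>
      intro h
      rcases hx with rfl | ⟨i, h₁, h₂, rfl⟩
      · rw [hΦt, map_pow, hρ 1 le_rfl hn, sq, Equiv.Perm.mul_apply, cosetPerm_pred 0,
          cosetPerm_self hn, Btconj]
      · rw [hΦs i h₁ h₂, hρ i (by omega) h₂, cosetPerm_of_succ_lt (by omega) h₂]
    | one => simp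
    | mul x y _ _ hx hy => intro h; rw [map_mul, map_mul, Equiv.Perm.mul_apply, hy, hx, mul_assoc]
    | inv x _ hx => intro h; rw [map_inv, map_inv, Equiv.Perm.inv_eq_iff_eq, hx, mul_inv_cancel_left]
  intro g h hgh
  have := key g 1
  rw [hgh, key h 1] at this
  simpa using this.symm

end CosetAction

/-- Let `n ≥ 2`, and let `π : Br_{n+1} → 𝔖_{n+1}` be the homomorphism
sending `s_i` to the transposition `(i, i+1)`. Then the assignment `t ↦ s₁²`,
`s_i ↦ s_i` (`2 ≤ i ≤ n`) defines an injective group homomorphism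
`Art(Bₙ) → Br_{n+1}` whose image is the subgroup
`Br¹_{n+1} = {b ∈ Br_{n+1} : π(b)(1) = 1}`, a subgroup of index `n+1` in `Br_{n+1}`. -/
theorem artinB_embeds_in_braid (n : ℕ) (hn : 2 ≤ n)
    (π : Braid n →* Equiv.Perm (Fin (n + 1)))
    (hπ : ∀ i : ℕ, ∀ h1 : 1 ≤ i, ∀ h2 : i ≤ n,
      π (Brs n i) = Equiv.swap ⟨i - 1, by omega⟩ ⟨i, by omega⟩) :
    ∃ Φ : ArtinB n →* Braid n,
      Φ (Bt n) = Brs n 1 ^ 2 ∧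
      (∀ i : ℕ, 2 ≤ i → i ≤ n → Φ (Bs n i) = Brs n i) ∧
      Function.Injective Φ ∧
      Φ.range = Subgroup.comap π
        (MulAction.stabilizer (Equiv.Perm (Fin (n + 1))) (⟨0, by omega⟩ : Fin (n + 1))) ∧
      (Subgroup.comap π
        (MulAction.stabilizer (Equiv.Perm (Fin (n + 1)))
          (⟨0, by omega⟩ : Fin (n + 1)))).index = n + 1 := by
  obtain ⟨Φ, hΦt, hΦs⟩ := ArtinB.exists_hom (n := n) hn (Brs n 1 ^ 2) (Brs n)
    (length_four_relation_sq (Brs_braid le_rfl hn))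
    (fun i h₁ h₂ => (Commute.pow_left (Brs_comm le_rfl h₁ h₂) 2 : Commute _ _))
    (fun i h₁ h₂ => Brs_braid (by omega) h₂) (fun i j h₁ h₂ h₃ => Brs_comm (by omega) h₂ h₃)
  have hrep : ∀ k (hk : k ≤ n), π (cosetRep n k) ⟨0, by omega⟩ = ⟨k, by omega⟩ := by
    intro k
    induction k with
    | zero => intro hk; simp [cosetRep]
    | succ k ih =>
      intro hk
      rw [cosetRep, map_mul, Equiv.Perm.mul_apply, ih (by omega), hπ (k + 1) (by omega) hk]
      exact Equiv.swap_apply_left _ _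
  have hfix : ∀ g, π (Φ g) ⟨0, by omega⟩ = ⟨0, by omega⟩ := by
    have hle : ⊤ ≤ Subgroup.comap (π.comp Φ)
        (MulAction.stabilizer (Equiv.Perm (Fin (n + 1))) (⟨0, by omega⟩ : Fin (n + 1))) := by
      rw [← ArtinB.closure_generators, Subgroup.closure_le]
      rintro _ (rfl | ⟨i, h₁, h₂, rfl⟩)
      · simp [hΦt, hπ 1 le_rfl (by omega), sq]
      · simp only [Subgroup.coe_comap, Set.mem_preimage, MonoidHom.comp_apply, SetLike.mem_coe,
          MulAction.mem_stabilizer_iff, hΦs i h₁ h₂, hπ i (by omega) h₂, Equiv.Perm.smul_def]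
        apply Equiv.swap_apply_of_ne_of_ne <;> simp only [ne_eq, Fin.mk.injEq] <;> omega
    exact fun g => hle (Subgroup.mem_top g)
  refine ⟨Φ, hΦt, hΦs, injective_of_map_generators hΦt hΦs (by omega), ?_, ?_⟩
  · ext b
    rw [Subgroup.mem_comap, MulAction.mem_stabilizer_iff, Equiv.Perm.smul_def]
    constructor
    · rintro ⟨g, rfl⟩
      exact hfix g
    · intro hb
      obtain ⟨k, hk, g, rfl⟩ := exists_eq_cosetRep_mul hΦt hΦs b
      rw [map_mul, Equiv.Perm.mul_apply, hfix, hrep k hk, Fin.mk.injEq] at hb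
      exact ⟨g, by simp [hb, cosetRep]⟩
  · let : MulAction (Braid n) (Fin (n + 1)) := MulAction.compHom _ π
    have horb : MulAction.orbit (Braid n) (⟨0, by omega⟩ : Fin (n + 1)) = Set.univ :=
      Set.eq_univ_of_forall fun k => ⟨cosetRep n k, hrep k (by omega)⟩
    have h := MulAction.index_stabilizer (Braid n) (⟨0, by omega⟩ : Fin (n + 1))
    rw [horb, Set.ncard_univ, Nat.card_fin] at h
    exact h
end
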